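/- arXiv:2305.04127 — 6 statements merged into one kernel-verified Lean document; each statement's English description precedes it below -/
import Mathlib

section
/- Let R > 0 and ℓ ≥ 1. Then det(V) = (1/√(2π))^ℓ · (∏_{r=0}^{ℓ−1} 1/r!) · ∫_{x_0 > x_1 > ⋯ > x_{ℓ−1}, x ∈ S^ℓ} e^{−(1/2) Σ_{c=0}^{ℓ−1} x_c²} · ∏_{0 ≤ c_1 < c_2 ≤ ℓ−1} (x_{c_1} − x_{c_2})² dx. -/
open MeasureTheory Real Finset

/-- Probabilists' Hermite polynomial evaluated at a real number. -/
noncomputable def hermiteR (j : ℕ) (x : ℝ) : ℝ := Polynomial.aeval x (Polynomial.hermite j)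

/-- `J_{f,j} = ∫_S f(x) · (1/(√(2π)·j!)) · e^{-x²/2} · h_j(x) dx`, where `S = [-R, R]`. -/
noncomputable def Jint (R : ℝ) (f : ℝ → ℝ) (j : ℕ) : ℝ :=
  ∫ x in Set.Icc (-R) R,
    f x * (1 / (Real.sqrt (2 * π) * (Nat.factorial j))) * Real.exp (-x ^ 2 / 2) * hermiteR j x

/-- The `ℓ×ℓ` matrix `V` with entries `V_{r,c} = J_{h_c, r}`. -/
noncomputable def Vmat (R : ℝ) (ℓ : ℕ) : Matrix (Fin ℓ) (Fin ℓ) ℝ :=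
  Matrix.of fun r c : Fin ℓ => Jint R (hermiteR c) r

namespace HermAux

noncomputable def w (x : ℝ) : ℝ := Real.exp (-x ^ 2 / 2)

noncomputable def D {n : ℕ} (x : Fin n → ℝ) : ℝ :=
  (Matrix.of fun i j : Fin n => hermiteR j (x i)).det

noncomputable def G {n : ℕ} (x : Fin n → ℝ) : ℝ :=
  D x * (∏ i : Fin n, hermiteR i (x i)) * ∏ i, w (x i)

lemma cont_h (j : ℕ) : Continuous (hermiteR j) := by
  unfold hermiteR
  fun_prop

lemma cont_w : Continuous w := by
  unfold w
  fun_prop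

lemma cont_D {n : ℕ} : Continuous (D (n := n)) := by
  unfold D
  refine Continuous.matrix_det ?_
  refine continuous_matrix fun i j => ?_
  exact (cont_h j).comp (continuous_apply i)

lemma D_eq {n : ℕ} (x : Fin n → ℝ) :
    D x = ∏ i : Fin n, ∏ j ∈ Finset.Ioi i, (x j - x i) := by
  rw [← Matrix.det_vandermonde, Matrix.det_eval_matrixOfPolynomials_eq_det_vandermonde x
    (fun i => (Polynomial.hermite i).map (algebraMap ℤ ℝ))]
  · simp [D, hermiteR, Polynomial.aeval_def, Polynomial.eval_map]
  · intro i
    rw [(Polynomial.hermite_monic i).natDegree_map, Polynomial.natDegree_hermite]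
  · intro i
    exact (Polynomial.hermite_monic i).map _

lemma D_sq {n : ℕ} (x : Fin n → ℝ) :
    D x ^ 2 = ∏ p ∈ Finset.univ.filter (fun p : Fin n × Fin n => p.1 < p.2),
              (x p.1 - x p.2) ^ 2 := by
  rw [D_eq, ← Finset.prod_pow, Finset.prod_filter, ← Finset.univ_product_univ,
    Finset.prod_product]
  refine Finset.prod_congr rfl fun i _ => ?_
  rw [← Finset.prod_pow, ← Finset.prod_filter]
  refine Finset.prod_congr (by ext; simp) fun j _ => by ring

lemma D_perm {n : ℕ} (x : Fin n → ℝ) (τ : Equiv.Perm (Fin n)) :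
    D (x ∘ τ) = (Equiv.Perm.sign τ : ℤ) * D x := by
  unfold D
  rw [← Matrix.det_permute]
  rfl

lemma sum_G {n : ℕ} (x : Fin n → ℝ) :
    ∑ τ : Equiv.Perm (Fin n), G (x ∘ τ) = D x ^ 2 * ∏ i, w (x i) := by
  have h : ∀ τ : Equiv.Perm (Fin n), G (x ∘ τ) =
      D x * (∏ i, w (x i)) * ((Equiv.Perm.sign τ : ℤ) * ∏ i : Fin n, hermiteR i (x (τ i))) := by
    intro τ
    unfold G
    rw [D_perm]
    have : ∏ i, w ((x ∘ τ) i) = ∏ i, w (x i) := Equiv.prod_comp τ (fun i => w (x i))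
    rw [this]
    simp only [Function.comp]
    ring
  simp_rw [h]
  rw [← Finset.mul_sum]
  have : D x = ∑ τ : Equiv.Perm (Fin n),
      ((Equiv.Perm.sign τ : ℤ) : ℝ) * ∏ i : Fin n, hermiteR i (x (τ i)) := by
    unfold D
    rw [Matrix.det_apply']
    rfl
  rw [← this]
  ring

lemma prod_w {n : ℕ} (x : Fin n → ℝ) :
    ∏ i, w (x i) = Real.exp (-(1 / 2) * ∑ c, (x c) ^ 2) := by
  unfold w
  rw [← Real.exp_sum, Finset.mul_sum]
  congr 1
  refine Finset.sum_congr rfl fun i _ => by ring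

noncomputable def μ (R : ℝ) : Measure ℝ := volume.restrict (Set.Icc (-R) R)

instance (R : ℝ) : IsFiniteMeasure (μ R) := by unfold μ; infer_instance

noncomputable def ν (R : ℝ) (n : ℕ) : Measure (Fin n → ℝ) := Measure.pi fun _ => μ R

instance (R : ℝ) (n : ℕ) : IsFiniteMeasure (ν R n) := by unfold ν; infer_instance

lemma ν_eq (R : ℝ) (n : ℕ) :
    ν R n = volume.restrict (Set.univ.pi fun _ : Fin n => Set.Icc (-R) R) := by
  unfold ν μ
  rw [volume_pi, Measure.restrict_pi_pi]

lemma integrable_one {R : ℝ} {f : ℝ → ℝ} (hf : Continuous f) : Integrable f (μ R) :=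
  hf.continuousOn.integrableOn_compact isCompact_Icc

lemma integrable_n {R : ℝ} {n : ℕ} {f : (Fin n → ℝ) → ℝ} (hf : Continuous f) :
    Integrable f (ν R n) := by
  rw [ν_eq]
  exact hf.continuousOn.integrableOn_compact (isCompact_univ_pi fun _ => isCompact_Icc)

lemma cont_G {n : ℕ} : Continuous (G (n := n)) := by
  unfold G
  refine (cont_D.mul ?_).mul ?_
  · exact continuous_finsetProd _ fun i _ => (cont_h i).comp (continuous_apply i)
  · exact continuous_finsetProd _ fun i _ => cont_w.comp (continuous_apply i)

lemma andreief (R : ℝ) (n : ℕ) :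
    (Matrix.of fun r c : Fin n => ∫ x, hermiteR r x * hermiteR c x * w x ∂(μ R)).det
      = ∫ x, G x ∂(ν R n) := by
  have hG : ∀ x : Fin n → ℝ, G x = ∑ σ : Equiv.Perm (Fin n), ((Equiv.Perm.sign σ : ℤ) : ℝ) *
      ∏ i : Fin n, (hermiteR (σ i) (x i) * hermiteR i (x i) * w (x i)) := by
    intro x
    unfold G D
    rw [← Matrix.det_transpose, Matrix.det_apply', Finset.sum_mul, Finset.sum_mul]
    refine Finset.sum_congr rfl fun σ _ => ?_
    simp only [Finset.prod_mul_distrib, Matrix.transpose_apply, Matrix.of_apply]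
    ring
  simp_rw [hG]
  rw [integral_finsetSum, Matrix.det_apply']
  · refine Finset.sum_congr rfl fun σ _ => ?_
    rw [integral_const_mul]
    congr 1
    unfold ν
    rw [integral_fintype_prod_eq_prod
      (fun (i : Fin n) (y : ℝ) => hermiteR (σ i) y * hermiteR i y * w y)]
    rfl
  · intro σ _
    refine integrable_n (continuous_const.mul (continuous_finsetProd _ fun i _ => ?_))
    exact (((cont_h _).mul (cont_h _)).mul cont_w).comp (continuous_apply i)

def O (n : ℕ) : Set (Fin n → ℝ) := {x | ∀ c₁ c₂ : Fin n, c₁ < c₂ → x c₂ < x c₁}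

lemma meas_O (n : ℕ) : MeasurableSet (O n) := by
  have : O n = ⋂ c₁ : Fin n, ⋂ c₂ : Fin n, ⋂ _ : c₁ < c₂, {x | x c₂ < x c₁} := by
    ext; simp [O]
  rw [this]
  refine MeasurableSet.iInter fun i => MeasurableSet.iInter fun j => MeasurableSet.iInter fun _ =>
    measurableSet_lt (measurable_pi_apply _) (measurable_pi_apply _)

lemma mem_O_iff {n : ℕ} {x : Fin n → ℝ} (hx : Function.Injective x) (τ : Equiv.Perm (Fin n)) :
    x ∘ τ ∈ O n ↔ τ = Tuple.sort (fun i => - x i) := by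
  rw [Tuple.eq_sort_iff]
  constructor
  · intro h
    have h' : StrictMono ((fun i => - x i) ∘ τ) := fun i j hij => neg_lt_neg (h i j hij)
    exact ⟨h'.monotone, fun i j hij he => absurd he (h' hij).ne⟩
  · rintro ⟨h, -⟩ i j hij
    have h1 : - x (τ i) ≤ - x (τ j) := h hij.le
    refine lt_of_le_of_ne (by simpa using h1) fun he => ?_
    exact hij.ne' (τ.injective (hx he))

lemma ae_inj (R : ℝ) (n : ℕ) : ∀ᵐ x ∂(ν R n), Function.Injective x := by
  rw [ν_eq]
  refine ae_restrict_of_ae ?_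
  have : ∀ i j : Fin n, ∀ᵐ x : Fin n → ℝ, i ≠ j → x i ≠ x j := by
    intro i j
    by_cases hij : i = j
    · simp [hij]
    let s : Submodule ℝ (Fin n → ℝ) :=
      LinearMap.ker (LinearMap.proj (R := ℝ) (φ := fun _ : Fin n => ℝ) i - LinearMap.proj j)
    have hs : s ≠ ⊤ := by
      intro h
      have : (Pi.single i 1 : Fin n → ℝ) ∈ s := by rw [h]; trivial
      simp [s, Pi.single_apply, Ne.symm hij] at this
    have h0 := Measure.addHaar_submodule volume s hs
    rw [ae_iff]
    refine measure_mono_null ?_ h0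
    intro x hx
    have : x i = x j := by simpa [hij] using hx
    simp [s, this]
  have h2 : ∀ᵐ x : Fin n → ℝ, ∀ i j : Fin n, i ≠ j → x i ≠ x j := by
    rw [ae_all_iff]; intro i; rw [ae_all_iff]; exact this i
  filter_upwards [h2] with x hx i j h
  by_contra hne
  exact hx i j hne h

lemma integral_perm (R : ℝ) {n : ℕ} (f : (Fin n → ℝ) → ℝ) (τ : Equiv.Perm (Fin n)) :
    ∫ x, f (x ∘ τ) ∂(ν R n) = ∫ x, f x ∂(ν R n) := by
  have h := (measurePreserving_piCongrLeft (fun _ : Fin n => μ R) τ.symm).integral_comp' f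
  unfold ν
  rw [← h]
  congr 1
  ext x
  congr 1
  ext i
  have := MeasurableEquiv.piCongrLeft_apply_apply τ.symm (β := fun _ => ℝ) x (τ i)
  rw [τ.symm_apply_apply] at this
  exact this.symm

lemma sym (R : ℝ) {n : ℕ} (f : (Fin n → ℝ) → ℝ) (hf : Continuous f) :
    ∫ x, f x ∂(ν R n) = ∫ x in O n, ∑ τ : Equiv.Perm (Fin n), f (x ∘ τ) ∂(ν R n) := by
  classical
  have hc : ∀ τ : Equiv.Perm (Fin n), Continuous fun x : Fin n → ℝ => x ∘ τ := fun τ =>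
    continuous_pi fun i => continuous_apply _
  have h1 : ∀ᵐ x ∂(ν R n), f x =
      ∑ τ : Equiv.Perm (Fin n), (O n).indicator (fun y => f (y ∘ τ.symm)) (x ∘ τ) := by
    filter_upwards [ae_inj R n] with x hx
    rw [Finset.sum_eq_single (Tuple.sort (fun i => - x i))]
    · rw [Set.indicator_of_mem ((mem_O_iff hx _).2 rfl)]
      congr 1
      ext i
      simp
    · intro τ _ hτ
      exact Set.indicator_of_notMem (fun h => hτ ((mem_O_iff hx _).1 h)) _
    · simp
  have hi : ∀ τ : Equiv.Perm (Fin n),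
      Integrable (fun x => (O n).indicator (fun y => f (y ∘ τ.symm)) (x ∘ τ)) (ν R n) := by
    intro τ
    have he : (fun x => (O n).indicator (fun y => f (y ∘ τ.symm)) (x ∘ τ)) =
        ((fun x : Fin n → ℝ => x ∘ τ) ⁻¹' O n).indicator f := by
      ext x
      by_cases hx : x ∘ τ ∈ O n
      · rw [Set.indicator_of_mem hx, Set.indicator_of_mem (by exact hx)]
        congr 1
        ext i
        simp
      · rw [Set.indicator_of_notMem hx, Set.indicator_of_notMem (by exact hx)]
    rw [he]
    exact (integrable_n hf).indicator ((hc τ).measurable (meas_O n))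
  rw [integral_congr_ae h1, integral_finsetSum _ fun τ _ => hi τ]
  have hi2 : ∀ τ : Equiv.Perm (Fin n),
      Integrable (fun x => f (x ∘ τ)) ((ν R n).restrict (O n)) := fun τ =>
    (integrable_n (hf.comp (hc τ))).integrableOn
  rw [integral_finsetSum _ fun τ _ => hi2 τ]
  rw [← Equiv.sum_comp (Equiv.inv (Equiv.Perm (Fin n)))]
  refine Finset.sum_congr rfl fun τ _ => ?_
  rw [integral_perm R, integral_indicator (meas_O n)]
  rfl

end HermAux

open HermAux in
/-- `det V = (1/√(2π))^ℓ · (∏_{r<ℓ} 1/r!) · ∫_{x₀ > ⋯ > x_{ℓ-1}, x ∈ S^ℓ}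
  e^{-(1/2)∑ x_c²} ∏_{c₁<c₂} (x_{c₁} - x_{c₂})² dx`. -/
theorem det_Vmat_eq (R : ℝ) (hR : 0 < R) (ℓ : ℕ) (hℓ : 1 ≤ ℓ) :
    (Vmat R ℓ).det =
      (1 / Real.sqrt (2 * π)) ^ ℓ * (∏ r : Fin ℓ, (1 : ℝ) / (Nat.factorial r)) *
        ∫ x in {x : Fin ℓ → ℝ | (∀ c, x c ∈ Set.Icc (-R) R) ∧
            (∀ c₁ c₂ : Fin ℓ, c₁ < c₂ → x c₂ < x c₁)},
          Real.exp (-(1 / 2) * ∑ c, (x c) ^ 2) *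
            ∏ p ∈ Finset.univ.filter (fun p : Fin ℓ × Fin ℓ => p.1 < p.2),
              (x p.1 - x p.2) ^ 2 := by
  have hV : Vmat R ℓ = Matrix.of fun r c : Fin ℓ =>
      (1 / Real.sqrt (2 * π) * (1 / (Nat.factorial r : ℝ))) *
      (Matrix.of fun r c : Fin ℓ => ∫ x, hermiteR r x * hermiteR c x * w x ∂(μ R)) r c := by
    ext r c
    simp only [Vmat, Jint, Matrix.of_apply]
    rw [← integral_const_mul]
    unfold μ w
    congr 1
    ext x
    rw [one_div_mul_one_div]
    ring
  rw [hV, Matrix.det_mul_column, andreief, sym R G cont_G, Finset.prod_mul_distrib,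
    Finset.prod_const, Finset.card_univ, Fintype.card_fin]
  congr 1
  have hset : {x : Fin ℓ → ℝ | (∀ c, x c ∈ Set.Icc (-R) R) ∧
            (∀ c₁ c₂ : Fin ℓ, c₁ < c₂ → x c₂ < x c₁)} =
      O ℓ ∩ (Set.univ.pi fun _ : Fin ℓ => Set.Icc (-R) R) := by
    ext x
    simp only [O, Set.mem_inter_iff, Set.mem_setOf_eq, Set.mem_univ_pi]
    exact and_comm
  rw [hset, ν_eq, Measure.restrict_restrict (meas_O ℓ)]
  congr 1
  ext x
  rw [sum_G, prod_w, D_sq, mul_comm]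
end

section
/- Let R > 0 and ℓ ≥ 1. Then det(V) > 0; in particular the matrix V is invertible. -/
open MeasureTheory Real Finset

noncomputable def hermiteSeq : Polynomial.Sequence ℝ where
  elems' n := (Polynomial.hermite n).map (Int.castRingHom ℝ)
  degree_eq' n := by
    rw [(Polynomial.hermite_monic n).degree_map, Polynomial.degree_hermite]

lemma hermiteSeq_eval (n : ℕ) (x : ℝ) : (hermiteSeq n).eval x = hermiteR n x := by
  change ((Polynomial.hermite n).map (Int.castRingHom ℝ)).eval x = _
  rw [hermiteR, Polynomial.aeval_def, Polynomial.eval_map]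
  rfl

lemma hermiteR_continuous (n : ℕ) : Continuous (hermiteR n) := by
  have : hermiteR n = fun x => (hermiteSeq n).eval x := by
    funext x; rw [hermiteSeq_eval]
  rw [this]; exact Polynomial.continuous _

noncomputable def Gmat (R : ℝ) (ℓ : ℕ) : Matrix (Fin ℓ) (Fin ℓ) ℝ :=
  Matrix.of fun r c : Fin ℓ =>
    ∫ x in (-R)..R, Real.exp (-x ^ 2 / 2) * (hermiteR r x * hermiteR c x)

lemma Vmat_eq (R : ℝ) (hR : 0 < R) (ℓ : ℕ) : Vmat R ℓ =
    Matrix.diagonal (fun r : Fin ℓ => 1 / (Real.sqrt (2 * π) * (Nat.factorial r))) * Gmat R ℓ := by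
  ext r c
  rw [Matrix.diagonal_mul]
  simp only [Vmat, Gmat, Matrix.of_apply, Jint]
  rw [← intervalIntegral.integral_const_mul, intervalIntegral.integral_of_le (by linarith),
    integral_Icc_eq_integral_Ioc]
  congr 1
  funext x
  ring

lemma Gmat_posDef (R : ℝ) (hR : 0 < R) (ℓ : ℕ) : (Gmat R ℓ).PosDef := by
  apply Matrix.PosDef.of_dotProduct_mulVec_pos
  · ext r c
    simp only [Gmat, Matrix.conjTranspose_apply, Matrix.of_apply, star_trivial]
    congr 1
    funext x
    ring
  · intro v hv
    have key : star v ⬝ᵥ (Gmat R ℓ).mulVec v =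
        ∫ x in (-R)..R, Real.exp (-x ^ 2 / 2) * (∑ i, v i * hermiteR i x) ^ 2 := by
      have : ∀ x : ℝ, Real.exp (-x ^ 2 / 2) * (∑ i, v i * hermiteR i x) ^ 2 =
          ∑ i, ∑ j, v i * v j * (Real.exp (-x ^ 2 / 2) * (hermiteR i x * hermiteR j x)) := by
        intro x
        rw [sq (∑ i, v i * hermiteR i x), Finset.sum_mul_sum, Finset.mul_sum]
        refine Finset.sum_congr rfl fun i _ => ?_
        rw [Finset.mul_sum]
        refine Finset.sum_congr rfl fun j _ => ?_
        ring
      simp_rw [this]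
      have hc := hermiteR_continuous
      have hi : ∀ i j : Fin ℓ, Continuous fun x : ℝ =>
          v i * v j * (Real.exp (-x ^ 2 / 2) * (hermiteR i x * hermiteR j x)) := by
        intro i j
        have := hc i
        have := hc j
        fun_prop
      rw [intervalIntegral.integral_finsetSum]
      · simp only [dotProduct, Matrix.mulVec, star_trivial]
        refine Finset.sum_congr rfl fun i _ => ?_
        rw [intervalIntegral.integral_finsetSum, Finset.mul_sum]
        · refine Finset.sum_congr rfl fun j _ => ?_
          rw [intervalIntegral.integral_const_mul]
          simp only [Gmat, Matrix.of_apply]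
          ring
        · intro j _
          exact (hi i j).intervalIntegrable _ _
      · intro i _
        exact (continuous_finsetSum _ fun j _ => hi i j).intervalIntegrable _ _
    rw [key]
    set p : Polynomial ℝ := ∑ i, v i • hermiteSeq i with hp
    have hpe : ∀ x, ∑ i, v i * hermiteR i x = p.eval x := by
      intro x
      simp [hp, Polynomial.eval_finsetSum, hermiteSeq_eval]
    simp_rw [hpe]
    have hp0 : p ≠ 0 := by
      intro h0
      have hli := hermiteSeq.linearIndependent.comp (Fin.val : Fin ℓ → ℕ) Fin.val_injective
      rw [Fintype.linearIndependent_iff] at hli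
      exact hv (funext (hli v h0))
    have hex : ∃ c ∈ Set.Icc (-R) R, p.eval c ≠ 0 := by
      by_contra! h
      apply hp0
      apply Polynomial.eq_zero_of_infinite_isRoot
      exact (Set.Icc_infinite (by linarith : -R < R)).mono h
    obtain ⟨c, hc, hne⟩ := hex
    apply intervalIntegral.integral_pos (by linarith)
    · have := p.continuous
      fun_prop
    · intro x _
      positivity
    · exact ⟨c, hc, by positivity⟩

/-- The matrix `V` has positive determinant; in particular it is invertible. -/
theorem det_Vmat_pos (R : ℝ) (hR : 0 < R) (ℓ : ℕ) (hℓ : 1 ≤ ℓ) :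
    0 < (Vmat R ℓ).det ∧ IsUnit (Vmat R ℓ) := by
  have h : 0 < (Vmat R ℓ).det := by
    rw [Vmat_eq R hR, Matrix.det_mul, Matrix.det_diagonal]
    refine mul_pos (Finset.prod_pos fun i _ => ?_) (Gmat_posDef R hR ℓ).det_pos
    positivity
  exact ⟨h, (Matrix.isUnit_iff_isUnit_det _).2 h.ne'.isUnit⟩
end

section
/- For every R > 0 there exist constants c > 0 and N ≥ 1 (depending only on R) such that for all integers k ≥ 1, ℓ ≥ 2(2k−1), 1 ≤ i ≤ 2k−1, and all j ≥ max(ℓ, N): |det(V^{(i→j)})| ≤ 2^{−c · j · log j} · |det(V)|. -/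
open MeasureTheory Real Finset

open Polynomial in
lemma aux_coeff_prod {ι : Type*} [DecidableEq ι] (s : Finset ι) (g : ι → ℝ[X]) (b : ι → ℝ)
    (hb : ∀ i ∈ s, 0 ≤ b i) (A : ℝ) (hA : 0 ≤ A)
    (hg : ∀ i ∈ s, ∃ u v : ℝ, g i = C u * (X - C v) ∧ |u| ≤ b i ∧ |v| ≤ A) (n : ℕ) :
    |(∏ i ∈ s, g i).coeff n| ≤ ∏ i ∈ s, (b i * (1 + A)) := by
  induction s using Finset.induction_on generalizing n with
  | empty =>
    simp only [Finset.prod_empty, coeff_one]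
    split_ifs <;> simp
  | insert a s ha ih =>
    rw [Finset.prod_insert ha, Finset.prod_insert ha]
    have hP : 0 ≤ ∏ i ∈ s, (b i * (1 + A)) := Finset.prod_nonneg fun i hi =>
      mul_nonneg (hb i (Finset.mem_insert_of_mem hi)) (by linarith)
    have ih' := ih (fun i hi => hb i (Finset.mem_insert_of_mem hi))
      (fun i hi => hg i (Finset.mem_insert_of_mem hi))
    obtain ⟨u, v, h, hu, hv⟩ := hg a (Finset.mem_insert_self _ _)
    rw [h, mul_assoc, coeff_C_mul, abs_mul, mul_assoc (b a)]
    refine mul_le_mul hu ?_ (abs_nonneg _) ((abs_nonneg _).trans hu)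
    rw [sub_mul, coeff_sub, coeff_C_mul]
    have h1 : |(X * ∏ i ∈ s, g i).coeff n| ≤ ∏ i ∈ s, (b i * (1 + A)) := by
      cases n with
      | zero => simpa using hP
      | succ n => rw [coeff_X_mul]; exact ih' n
    have h2 : |v * (∏ i ∈ s, g i).coeff n| ≤ A * ∏ i ∈ s, (b i * (1 + A)) := by
      rw [abs_mul]
      exact mul_le_mul hv (ih' n) (abs_nonneg _) hA
    calc _ ≤ _ := abs_sub _ _
      _ ≤ _ := add_le_add h1 h2
      _ = _ := by ring

lemma aux_prod_half (L : ℝ) (hL : 0 ≤ L) (m : ℕ) :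
    ∏ b ∈ Finset.range m, (L / ((b : ℝ) + 1)) ≤ Real.exp L := by
  have : ∏ b ∈ Finset.range m, (L / ((b : ℝ) + 1)) = L ^ m / (m.factorial : ℝ) := by
    rw [Finset.prod_div_distrib, ← Finset.prod_range_add_one_eq_factorial]
    push_cast
    simp
  rw [this]
  exact Real.pow_div_factorial_le_exp L hL m

lemma aux_prod_dist (ℓ a : ℕ) (ha : a < ℓ) :
    ∏ b ∈ (Finset.range ℓ).erase a, ((ℓ : ℝ) / |(a : ℝ) - b|) ≤ Real.exp ℓ * Real.exp ℓ := by
  obtain ⟨m, rfl⟩ : ∃ m, ℓ = a + 1 + m := ⟨ℓ - (a+1), by omega⟩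
  set L : ℝ := ((a + 1 + m : ℕ) : ℝ) with hLdef
  have hL : 0 ≤ L := by positivity
  let G : ℕ → ℝ := fun b => if b = a then 1 else L / |(a : ℝ) - b|
  have h1 : ∏ b ∈ (Finset.range (a+1+m)).erase a, (L / |(a : ℝ) - b|)
      = ∏ b ∈ (Finset.range (a+1+m)).erase a, G b := by
    refine Finset.prod_congr rfl fun b hb => ?_
    simp only [G, if_neg (Finset.ne_of_mem_erase hb)]
  have h2 : ∏ b ∈ (Finset.range (a+1+m)).erase a, G b = ∏ b ∈ Finset.range (a+1+m), G b := by
    apply Finset.prod_erase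
    simp [G]
  rw [h1, h2, Finset.prod_range_add, Finset.prod_range_succ]
  have h3 : G a = 1 := by simp [G]
  rw [h3, mul_one]
  have h4 : ∏ b ∈ Finset.range a, G b = ∏ b ∈ Finset.range a, (L / ((b : ℝ) + 1)) := by
    rw [← Finset.prod_range_reflect (fun b : ℕ => L / ((b : ℝ) + 1))]
    refine Finset.prod_congr rfl fun b hb => ?_
    have hb' := Finset.mem_range.1 hb
    simp only [G, if_neg hb'.ne]
    have : ((a - 1 - b : ℕ) : ℝ) = (a : ℝ) - 1 - b := by
      rw [Nat.cast_sub (by omega), Nat.cast_sub (by omega)]; simp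
    rw [this, abs_of_nonneg (by have : (b:ℝ) ≤ a := by exact_mod_cast hb'.le
                                linarith)]
    congr 1; ring
  have h5 : ∏ b ∈ Finset.range m, G (a + 1 + b) = ∏ b ∈ Finset.range m, (L / ((b : ℝ) + 1)) := by
    refine Finset.prod_congr rfl fun b hb => ?_
    have : a + 1 + b ≠ a := by omega
    simp only [G, if_neg this]
    congr 1
    push_cast
    rw [show (a : ℝ) - (a + 1 + b) = -((b : ℝ) + 1) by ring, abs_neg, abs_of_nonneg (by positivity)]
  rw [h4, h5]
  refine mul_le_mul (aux_prod_half L hL a) (aux_prod_half L hL m) ?_ (Real.exp_nonneg _)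
  exact Finset.prod_nonneg fun b _ => by positivity

open Polynomial in
lemma aux_node (R : ℝ) (hR : 0 < R) (q : ℝ[X]) (B : ℝ) (hB : 0 ≤ B)
    (hq : ∫ x in Set.Icc (-R) R, (q.eval x) ^ 2 ≤ B ^ 2) (ℓ a : ℕ) (ha : a < ℓ) :
    ∃ x : ℝ, -R + 2 * a * (R / ℓ) ≤ x ∧ x ≤ -R + (2 * a + 1) * (R / ℓ) ∧ x ≤ R ∧
      |q.eval x| ≤ Real.sqrt (ℓ / R) * B := by
  have hℓ : (0 : ℝ) < ℓ := by exact_mod_cast (Nat.zero_le a).trans_lt ha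
  have hδ : 0 < R / ℓ := by positivity
  have hdl : R / ℓ * ℓ = R := by field_simp
  set δ := R / ℓ with hδd
  set I := Set.Icc (-R + 2 * a * δ) (-R + (2 * a + 1) * δ) with hI
  have ha' : (a : ℝ) + 1 ≤ ℓ := by exact_mod_cast ha
  have hup : -R + (2 * a + 1) * δ ≤ R := by nlinarith
  have hsub : I ⊆ Set.Icc (-R) R := by
    intro x hx
    refine ⟨le_trans ?_ hx.1, hx.2.trans hup⟩
    have : 0 ≤ 2 * (a:ℝ) * δ := by positivity
    linarith
  have hvol : volume I = ENNReal.ofReal δ := by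
    rw [hI, Real.volume_Icc]; congr 1; ring
  have hcont : Continuous fun x => (q.eval x) ^ 2 := by fun_prop
  have hint : IntegrableOn (fun x => (q.eval x) ^ 2) I := hcont.continuousOn.integrableOn_Icc
  obtain ⟨x, hx, hle⟩ := exists_le_setAverage (μ := volume) (s := I)
    (f := fun x => (q.eval x)^2) (by rw [hvol]; simpa using hδ) (by rw [hvol]; simp) hint
  refine ⟨x, hx.1, hx.2, hx.2.trans hup, ?_⟩
  have hmono : ∫ x in I, (q.eval x)^2 ≤ B^2 :=
    le_trans (setIntegral_mono_set hcont.continuousOn.integrableOn_Icc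
      (Filter.Eventually.of_forall fun x => sq_nonneg _) (Filter.Eventually.of_forall hsub)) hq
  rw [setAverage_eq, measureReal_def, hvol, ENNReal.toReal_ofReal hδ.le, smul_eq_mul] at hle
  have h1 : (q.eval x)^2 ≤ (Real.sqrt (ℓ / R) * B)^2 := by
    rw [mul_pow, Real.sq_sqrt (by positivity)]
    refine hle.trans ?_
    rw [hδd, inv_div]
    exact mul_le_mul_of_nonneg_left hmono (by positivity)
  exact abs_le_of_sq_le_sq h1 (by positivity)

open Polynomial in
lemma aux_coeff_bound (R : ℝ) (hR : 0 < R) : ∃ C : ℝ, 1 ≤ C ∧ ∀ (ℓ : ℕ) (q : ℝ[X]) (B : ℝ),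
    0 ≤ B → q.degree < ℓ → ∫ x in Set.Icc (-R) R, (q.eval x) ^ 2 ≤ B ^ 2 →
    ∀ n, |q.coeff n| ≤ C ^ ℓ * B := by
  refine ⟨Real.exp 1 * (Real.exp 1 * (1 + 1/R)) * (Real.exp 1 * Real.exp 1) * ((1+1/R) * (1 + R)), ?_, ?_⟩
  · have h1 : 1 ≤ Real.exp 1 := Real.one_le_exp (by norm_num)
    have h2 : 1 ≤ 1 + 1/R := by have : 0 ≤ 1/R := by positivity
                                linarith
    exact one_le_mul_of_one_le_of_one_le (one_le_mul_of_one_le_of_one_le (one_le_mul_of_one_le_of_one_le h1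
      (one_le_mul_of_one_le_of_one_le h1 h2)) (one_le_mul_of_one_le_of_one_le h1 h1))
      (one_le_mul_of_one_le_of_one_le h2 (by linarith))
  intro ℓ q B hB hdeg hq n
  choose! x hx1 hx2 hx3 hx4 using fun a (ha : a < ℓ) => aux_node R hR q B hB hq ℓ a ha
  have hxR : ∀ a < ℓ, |x a| ≤ R := by
    intro a ha
    rw [abs_le]
    refine ⟨le_trans ?_ (hx1 a ha), hx3 a ha⟩
    have : 0 ≤ 2 * (a:ℝ) * (R/ℓ) := by positivity
    linarith
  have hsep1 : ∀ a < ℓ, ∀ b < ℓ, b < a → ((a:ℝ) - b) * (R / ℓ) ≤ x a - x b := by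
    intro a ha b hb hab
    have h1 := hx1 a ha
    have h2 := hx2 b hb
    have hδ : 0 ≤ R / ℓ := by positivity
    have h3 : (b:ℝ) + 1 ≤ a := by exact_mod_cast hab
    nlinarith
  have hsep : ∀ a < ℓ, ∀ b < ℓ, b ≠ a → |(a:ℝ) - b| * (R / ℓ) ≤ |x a - x b| := by
    intro a ha b hb hab
    rcases lt_or_gt_of_ne hab with h | h
    · refine le_trans (le_of_eq ?_) ((hsep1 a ha b hb h).trans (le_abs_self _))
      rw [abs_of_nonneg]; have : (b:ℝ) ≤ a := by exact_mod_cast h.le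
      linarith
    · rw [abs_sub_comm, abs_sub_comm (x a)]
      refine le_trans (le_of_eq ?_) ((hsep1 b hb a ha h).trans (le_abs_self _))
      rw [abs_of_nonneg]; have : (a:ℝ) ≤ b := by exact_mod_cast h.le
      linarith
  have hpos : ∀ a < ℓ, ∀ b < ℓ, b ≠ a → 0 < |(a:ℝ) - b| * (R / ℓ) := by
    intro a ha b hb hab
    have : (0:ℝ) < ℓ := by exact_mod_cast (Nat.zero_le a).trans_lt ha
    have h2 : (a:ℝ) - b ≠ 0 := by
      rw [sub_ne_zero]; exact_mod_cast hab.symm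
    positivity
  have hinj : Set.InjOn x (Finset.range ℓ : Set ℕ) := by
    intro a ha b hb hab
    by_contra hne
    have ha' : a < ℓ := by simpa using ha
    have hb' : b < ℓ := by simpa using hb
    have h1 := hsep a ha' b hb' (Ne.symm hne)
    have h2 := hpos a ha' b hb' (Ne.symm hne)
    rw [hab, sub_self, abs_zero] at h1
    linarith
  have hinterp := Lagrange.eq_interpolate (s := Finset.range ℓ) (v := x) (f := q) hinj (by simpa using hdeg)
  rw [hinterp, Lagrange.interpolate_apply, finsetSum_coeff]
  have hbasis : ∀ a ∈ Finset.range ℓ, |(Lagrange.basis (Finset.range ℓ) x a).coeff n| ≤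
      (Real.exp ℓ * Real.exp ℓ) * ((1 + 1/R) * (1 + R)) ^ ℓ := by
    intro a ha
    have ha' := Finset.mem_range.1 ha
    rw [Lagrange.basis]
    refine (aux_coeff_prod _ _ (fun b : ℕ => ((ℓ:ℝ) / |(a:ℝ) - (b:ℝ)|) * (1/R)) ?_ R hR.le ?_ n).trans ?_
    · intro b hb; positivity
    · intro b hb
      have hb' := Finset.mem_range.1 (Finset.mem_of_mem_erase hb)
      have hne := Finset.ne_of_mem_erase hb
      refine ⟨(x a - x b)⁻¹, x b, rfl, ?_, hxR b hb'⟩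
      rw [abs_inv]
      refine (inv_anti₀ (hpos a ha' b hb' hne) (hsep a ha' b hb' hne)).trans (le_of_eq ?_)
      rw [mul_inv, inv_div]; field_simp
    · simp_rw [mul_assoc]
      rw [Finset.prod_mul_distrib, Finset.prod_const]
      rw [← mul_assoc (Real.exp ℓ)]
      refine mul_le_mul (aux_prod_dist ℓ a ha') ?_ (by positivity) (by positivity)
      have h0 : 0 < 1 / R := by positivity
      calc (1 / R * (1 + R)) ^ _ ≤ ((1 + 1/R) * (1+R)) ^ _ := by
            gcongr; linarith
        _ ≤ _ := by
            apply pow_le_pow_right₀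
            · nlinarith
            · rw [Finset.card_erase_of_mem ha]; simp
  have hsq : Real.sqrt (ℓ / R) ≤ (Real.exp 1 * (1 + 1/R)) ^ ℓ := by
    rw [Real.sqrt_le_iff]
    have h0 : 0 < 1 / R := by positivity
    refine ⟨by positivity, ?_⟩
    rcases Nat.eq_zero_or_pos ℓ with h | h
    · subst h; simp
    rw [mul_pow, mul_pow, ← Real.exp_nat_mul, mul_one, div_eq_mul_one_div]
    have h1 : (ℓ:ℝ) ≤ Real.exp ℓ := by linarith [Real.add_one_le_exp (ℓ:ℝ)]
    have h3 : Real.exp ℓ ≤ Real.exp ℓ ^ 2 := by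
      apply le_self_pow₀ (Real.one_le_exp (by positivity)) (by norm_num)
    have h2 : 1/R ≤ ((1 + 1/R)^ℓ)^2 := by
      rw [← pow_mul]
      calc 1/R ≤ 1 + 1/R := by linarith
        _ ≤ _ := le_self_pow₀ (by linarith) (by omega)
    exact mul_le_mul (h1.trans h3) h2 h0.le (by positivity)
  calc _ ≤ ∑ a ∈ Finset.range ℓ, |(C (q.eval (x a)) * Lagrange.basis (Finset.range ℓ) x a).coeff n| :=
        Finset.abs_sum_le_sum_abs _ _
    _ ≤ ∑ a ∈ Finset.range ℓ, (((Real.exp 1 * (1 + 1/R)) ^ ℓ * B) *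
          ((Real.exp ℓ * Real.exp ℓ) * ((1 + 1/R) * (1 + R)) ^ ℓ)) := by
        refine Finset.sum_le_sum fun a ha => ?_
        rw [coeff_C_mul, abs_mul]
        refine mul_le_mul ?_ (hbasis a ha) (abs_nonneg _) (by positivity)
        exact (hx4 a (Finset.mem_range.1 ha)).trans (mul_le_mul_of_nonneg_right hsq hB)
    _ = ℓ * (((Real.exp 1 * (1 + 1/R)) ^ ℓ * B) *
          ((Real.exp ℓ * Real.exp ℓ) * ((1 + 1/R) * (1 + R)) ^ ℓ)) := by simp
    _ ≤ Real.exp ℓ * (((Real.exp 1 * (1 + 1/R)) ^ ℓ * B) *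
          ((Real.exp ℓ * Real.exp ℓ) * ((1 + 1/R) * (1 + R)) ^ ℓ)) := by
        refine mul_le_mul_of_nonneg_right ?_ (by positivity)
        linarith [Real.add_one_le_exp (ℓ:ℝ)]
    _ = _ := by
        have : Real.exp ℓ = Real.exp 1 ^ ℓ := by rw [← Real.exp_nat_mul, mul_one]
        rw [this]; simp only [mul_pow]; ring

open Polynomial in
/-- real Hermite polynomial -/
noncomputable def HH (j : ℕ) : ℝ[X] := (hermite j).map (Int.castRingHom ℝ)

lemma hermiteR_eq (j : ℕ) (x : ℝ) : hermiteR j x = (HH j).eval x := by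
  unfold hermiteR HH
  rw [Polynomial.aeval_def, Polynomial.eval_map]; rfl

open Polynomial in
lemma HH_succ (n : ℕ) : HH (n+1) = X * HH n - derivative (HH n) := by
  unfold HH
  rw [hermite_succ]; simp [derivative_map]

open Polynomial in
lemma HH_zero : HH 0 = 1 := by simp [HH]

open Polynomial in
lemma derivative_HH_succ (n : ℕ) : derivative (HH (n+1)) = ((n:ℝ)+1) • HH n := by
  induction n with
  | zero => simp [HH_succ, HH_zero]
  | succ n ih =>
    rw [HH_succ (n+1), derivative_sub, derivative_mul, derivative_X, ih, derivative_smul, HH_succ n]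
    simp only [smul_eq_C_mul]
    push_cast
    simp only [map_add, map_one]
    ring

open Polynomial in
/-- Gaussian moments -/
noncomputable def mom (m : ℕ) : ℝ := if Even m then ((m - 1).doubleFactorial : ℝ) else 0

lemma mom_zero : mom 0 = 1 := by simp [mom]
lemma mom_one : mom 1 = 0 := by simp [mom]
lemma mom_nonneg (m : ℕ) : 0 ≤ mom m := by unfold mom; split_ifs <;> positivity
lemma mom_add_two (m : ℕ) : mom (m+2) = (m+1) * mom m := by
  unfold mom
  have : Even (m+2) ↔ Even m := by simp [parity_simps]
  simp only [this]
  split_ifs with h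
  · rcases m with _ | m
    · simp
    · simp only [Nat.add_sub_cancel]
      rw [show m + 1 + 2 - 1 = m + 2 by omega, Nat.doubleFactorial_add_two]
      push_cast; ring
  · simp

lemma mom_even (k : ℕ) : mom (2*k) = ((2*k).factorial : ℝ) / (2^k * k.factorial) := by
  induction k with
  | zero => simp [mom_zero]
  | succ k ih =>
    rw [show 2*(k+1) = 2*k+2 by ring, mom_add_two, ih, Nat.factorial_succ, Nat.factorial_succ (2*k),
      Nat.factorial_succ k]
    push_cast
    field_simp
    ring

lemma mom_le (s : ℝ) (hs : 0 < s) (m : ℕ) : mom m ≤ m.factorial * (Real.exp (s^2) / s^m) := by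
  rcases Nat.even_or_odd' m with ⟨k, rfl | rfl⟩
  · rw [mom_even, div_eq_mul_inv]
    refine mul_le_mul_of_nonneg_left ?_ (by positivity)
    have h := Real.pow_div_factorial_le_exp (s^2) (by positivity) k
    rw [pow_mul, le_div_iff₀ (by positivity)]
    refine le_trans ?_ h
    rw [inv_mul_eq_div]
    apply div_le_div_of_nonneg_left (by positivity) (by positivity)
    have : (1:ℝ) ≤ 2^k := one_le_pow₀ (by norm_num)
    nlinarith [(show (0:ℝ) < k.factorial by positivity)]
  · have : mom (2*k+1) = 0 := by unfold mom; simp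
    rw [this]; positivity

open Polynomial in
lemma HH_coeff_abs (j n : ℕ) : |(HH j).coeff n| = mom (j-n) * (j.choose n) := by
  unfold HH
  rw [coeff_map, coeff_hermite]
  rcases le_or_gt n j with h | h
  · have : Even (j + n) ↔ Even (j - n) := by
      rw [Nat.even_sub h, Nat.even_add]
    simp only [this, mom]
    split_ifs
    · simp [abs_mul]
    · simp
  · rw [Nat.choose_eq_zero_of_lt h]; simp

open Polynomial in
lemma HH_coeff_le (s : ℝ) (hs : 0 < s) (j n : ℕ) (hj : s^2 = j) (hn : n ≤ j) :
    |(HH j).coeff n| ≤ Real.exp j * s^(j+n) / n.factorial := by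
  rw [HH_coeff_abs]
  have h1 := mom_le s hs (j-n)
  have h2 : (j.choose n : ℝ) = j.factorial / (n.factorial * (j-n).factorial) := Nat.cast_choose ℝ hn
  have h3 : (j.factorial : ℝ) ≤ s^(2*j) := by
    rw [pow_mul, hj]; exact_mod_cast Nat.factorial_le_pow j
  rw [hj] at h1
  calc mom (j-n) * (j.choose n) ≤ ((j-n).factorial * (Real.exp j / s^(j-n))) * (j.factorial / (n.factorial * (j-n).factorial)) := by
        rw [h2]; gcongr
    _ = Real.exp j / s^(j-n) * j.factorial / n.factorial := by field_simp
    _ ≤ Real.exp j / s^(j-n) * s^(2*j) / n.factorial := by gcongr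
    _ = _ := by
      rw [show 2*j = (j-n) + (j+n) by omega, pow_add]; field_simp

open Polynomial in
/-- the Gaussian expectation functional -/
noncomputable def EE : ℝ[X] →ₗ[ℝ] ℝ := (Polynomial.basisMonomials ℝ).constr ℝ mom

open Polynomial in
lemma EE_monomial (n : ℕ) (a : ℝ) : EE (monomial n a) = a * mom n := by
  have h : EE (monomial n 1) = mom n := by
    have := (Polynomial.basisMonomials ℝ).constr_basis ℝ mom n
    rwa [coe_basisMonomials] at this
  have h2 : monomial n a = a • (monomial n (1:ℝ)) := by rw [smul_monomial]; simp
  rw [h2, map_smul, h, smul_eq_mul]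

open Polynomial in
lemma EE_stein (p : ℝ[X]) : EE (X * p) = EE (derivative p) := by
  induction p using Polynomial.induction_on' with
  | add p q hp hq => rw [mul_add, map_add, hp, hq, derivative_add, map_add]
  | monomial n a =>
    rw [X_mul_monomial, derivative_monomial, EE_monomial, EE_monomial]
    rcases n with _ | _ | n
    · simp [mom_one]
    · simp [mom_add_two]
    · rw [show n + 1 + 1 + 1 = (n+1) + 2 by ring, mom_add_two]
      simp only [Nat.add_sub_cancel]
      push_cast; ring

open Polynomial in
/-- the functional `p ↦ E[p^{(i)}]` -/
noncomputable def FF (i : ℕ) : ℝ[X] →ₗ[ℝ] ℝ := EE ∘ₗ ((derivative : ℝ[X] →ₗ[ℝ] ℝ[X]) ^ i)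

open Polynomial in
lemma FF_succ (i : ℕ) (p : ℝ[X]) : FF (i+1) p = FF i (derivative p) := by
  simp [FF, pow_succ]

open Polynomial in
lemma FF_HH (i r : ℕ) : FF i (HH r) = if r = i then (i.factorial : ℝ) else 0 := by
  induction i generalizing r with
  | zero =>
    cases r with
    | zero =>
      have := EE_monomial 0 1
      simpa [FF, HH_zero, mom_zero] using this
    | succ r => simp [FF, HH_succ, EE_stein]
  | succ i ih =>
    rw [FF_succ]
    cases r with
    | zero => simp [HH_zero]
    | succ r =>
      rw [derivative_HH_succ, map_smul, ih]
      by_cases h : r = i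
      · subst h; simp [Nat.factorial_succ]
      · simp [h]

open Polynomial in
lemma FF_monomial (i n : ℕ) (a : ℝ) : FF i (monomial n a) =
    if i ≤ n then a * (n.factorial / (n-i).factorial) * mom (n-i) else 0 := by
  induction i generalizing n a with
  | zero => simp [FF, EE_monomial]; left; field_simp
  | succ i ih =>
    rw [FF_succ, derivative_monomial, ih]
    cases n with
    | zero => simp
    | succ n =>
      simp only [Nat.add_sub_cancel, add_le_add_iff_right, Nat.factorial_succ, Nat.add_sub_add_right]
      split_ifs
      · push_cast; ring
      · rfl

open Polynomial in
lemma FF_abs_le (s : ℝ) (hs : 0 < s) (i n : ℕ) (a : ℝ) : |FF i (monomial n a)| ≤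
    if i ≤ n then |a| * (n.factorial * (Real.exp (s^2) / s^(n-i))) else 0 := by
  rw [FF_monomial]
  split_ifs
  · rw [abs_mul, abs_mul, mul_assoc, abs_of_nonneg (mom_nonneg _), abs_of_nonneg
      (show (0:ℝ) ≤ n.factorial / (n-i).factorial by positivity)]
    refine mul_le_mul_of_nonneg_left ?_ (abs_nonneg a)
    calc _ ≤ (n.factorial / (n-i).factorial : ℝ) * ((n-i).factorial * (Real.exp (s^2) / s^(n-i))) := by
          gcongr; exact mom_le s hs _
      _ = _ := by field_simp
  · simp

open Polynomial in
lemma span_HH (φ : ℝ[X] →ₗ[ℝ] ℝ) (ℓ : ℕ) (h : ∀ a < ℓ, φ (HH a) = 0) (p : ℝ[X])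
    (hp : p.degree < ℓ) : φ p = 0 := by
  have hX : ∀ n < ℓ, φ (monomial n 1) = 0 := by
    intro n
    induction n using Nat.strong_induction_on with
    | _ n ih =>
      intro hn
      have h1 : HH n = ∑ m ∈ Finset.range (n+1), monomial m ((HH n).coeff m) := by
        apply as_sum_range'
        unfold HH
        refine lt_of_le_of_lt natDegree_map_le ?_
        rw [natDegree_hermite]; omega
      have h2 := h n hn
      rw [h1, map_sum, Finset.sum_range_succ, Finset.sum_eq_zero] at h2
      · have : (HH n).coeff n = 1 := by simp [HH]
        rwa [this, zero_add] at h2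
      · intro m hm
        have hm' := Finset.mem_range.1 hm
        have : monomial m ((HH n).coeff m) = (HH n).coeff m • monomial m (1:ℝ) := by
          rw [smul_monomial]; simp
        rw [this, map_smul, ih m hm' (hm'.trans hn), smul_zero]
  rcases eq_or_ne p 0 with h0 | h0
  · rw [h0, map_zero]
  rw [as_sum_range_C_mul_X_pow' (n := ℓ) (p := p) ((natDegree_lt_iff_degree_lt h0).2 hp), map_sum]
  refine Finset.sum_eq_zero fun n hn => ?_
  rw [← smul_eq_C_mul, map_smul, X_pow_eq_monomial, hX n (Finset.mem_range.1 hn), smul_zero]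

open Polynomial in
lemma BL_int (R : ℝ) (p : ℝ[X]) :
    IntegrableOn (fun x => p.eval x * Real.exp (-x^2/2)) (Set.Icc (-R) R) := by
  apply ContinuousOn.integrableOn_Icc
  apply Continuous.continuousOn
  fun_prop

open Polynomial in
/-- weighted integral functional -/
noncomputable def BL (R : ℝ) : ℝ[X] →ₗ[ℝ] ℝ where
  toFun p := ∫ x in Set.Icc (-R) R, p.eval x * Real.exp (-x^2/2)
  map_add' p q := by
    rw [← integral_add (BL_int R p) (BL_int R q)]
    congr 1; ext x; rw [eval_add, add_mul]
  map_smul' a p := by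
    simp only [eval_smul, smul_eq_mul, mul_assoc, RingHom.id_apply]
    rw [integral_const_mul]

open Polynomial in
lemma BL_apply (R : ℝ) (p : ℝ[X]) :
    BL R p = ∫ x in Set.Icc (-R) R, p.eval x * Real.exp (-x^2/2) := rfl

lemma Jint_eq (R : ℝ) (a j : ℕ) : Jint R (hermiteR a) j =
    (Real.sqrt (2 * π))⁻¹ * ((j.factorial : ℝ)⁻¹ * BL R (HH a * HH j)) := by
  unfold Jint
  rw [BL_apply, ← integral_const_mul, ← integral_const_mul]
  congr 1; ext x
  rw [hermiteR_eq, hermiteR_eq, Polynomial.eval_mul, one_div, mul_inv]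
  ring

open Polynomial in
lemma L2_bound (R : ℝ) (hR : 0 < R) (q g : ℝ[X]) (G : ℝ) (hG : 0 ≤ G)
    (h : BL R (q * q) = BL R (q * g)) (hg : ∀ x, |x| ≤ R → |g.eval x| ≤ G) :
    ∫ x in Set.Icc (-R) R, (q.eval x)^2 ≤ (Real.sqrt (2 * R * Real.exp (R^2/2)) * G)^2 := by
  have h1 : BL R (q * g) ≤ BL R ((1/2:ℝ) • (q*q) + (1/2:ℝ) • (g * g)) := by
    rw [BL_apply, BL_apply]
    refine setIntegral_mono (BL_int R _) (BL_int R _) fun x => ?_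
    refine mul_le_mul_of_nonneg_right ?_ (Real.exp_nonneg _)
    simp only [eval_mul, eval_add, eval_smul, smul_eq_mul]
    nlinarith [sq_nonneg (q.eval x - g.eval x)]
  rw [map_add, map_smul, map_smul, smul_eq_mul, smul_eq_mul] at h1
  have h2 : BL R (q*q) ≤ BL R (g*g) := by linarith
  have h3 : BL R (g*g) ≤ 2 * R * G^2 := by
    rw [BL_apply]
    have : ∫ x in Set.Icc (-R) R, (g*g).eval x * Real.exp (-x^2/2) ≤ ∫ x in Set.Icc (-R) R, G^2 := by
      refine setIntegral_mono_on (BL_int R _) (by simp) measurableSet_Icc fun x hx => ?_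
      have hx' : |x| ≤ R := abs_le.2 hx
      have h4 := hg x hx'
      have h5 : Real.exp (-x^2/2) ≤ 1 := by
        rw [Real.exp_le_one_iff]; nlinarith [sq_nonneg x]
      have h6 : (g*g).eval x ≤ G^2 := by
        rw [eval_mul, ← sq, ← sq_abs]; gcongr
      calc _ ≤ G^2 * 1 := mul_le_mul h6 h5 (Real.exp_nonneg _) (by positivity)
        _ = _ := mul_one _
    refine this.trans (le_of_eq ?_)
    rw [setIntegral_const, measureReal_def, Real.volume_Icc, ENNReal.toReal_ofReal (by linarith), smul_eq_mul]
    ring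
  have h7 : ∫ x in Set.Icc (-R) R, (q.eval x)^2 ≤ Real.exp (R^2/2) * BL R (q*q) := by
    rw [BL_apply, ← integral_const_mul]
    refine setIntegral_mono_on ?_ ((BL_int R _).const_mul _) measurableSet_Icc fun x hx => ?_
    · apply ContinuousOn.integrableOn_Icc
      apply Continuous.continuousOn
      fun_prop
    have hx' : x^2 ≤ R^2 := sq_le_sq' hx.1 hx.2
    rw [eval_mul, ← sq, mul_left_comm, ← Real.exp_add]
    refine le_mul_of_one_le_right (sq_nonneg _) (Real.one_le_exp ?_)
    linarith
  rw [mul_pow, Real.sq_sqrt (by positivity)]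
  calc _ ≤ _ := h7
    _ ≤ Real.exp (R^2/2) * (2 * R * G^2) := by gcongr; exact h2.trans h3
    _ = _ := by ring

open Polynomial in
/-- truncation -/
noncomputable def trunc' (p : ℝ[X]) (ℓ : ℕ) : ℝ[X] := ∑ n ∈ Finset.range ℓ, monomial n (p.coeff n)

open Polynomial in
lemma trunc_coeff (p : ℝ[X]) (ℓ n : ℕ) (hn : n < ℓ) : (trunc' p ℓ).coeff n = p.coeff n := by
  unfold trunc'
  rw [finsetSum_coeff]
  simp only [coeff_monomial]
  rw [Finset.sum_ite_eq' (Finset.range ℓ) n]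
  simp [hn]

open Polynomial in
lemma trunc_degree (p : ℝ[X]) (ℓ : ℕ) : (trunc' p ℓ).degree < ℓ := by
  rw [← mem_degreeLT]
  unfold trunc'
  refine Submodule.sum_mem _ fun n hn => ?_
  rw [mem_degreeLT]
  refine (degree_monomial_le _ _).trans_lt ?_
  exact_mod_cast Finset.mem_range.1 hn

open Polynomial in
lemma HH_degree_lt (r ℓ : ℕ) (h : r < ℓ) : (HH r).degree < ℓ := by
  unfold HH
  refine degree_map_le.trans_lt ?_
  rw [degree_hermite]; exact_mod_cast h

open Polynomial in
lemma tail_bound (R : ℝ) (hR : 0 < R) (s : ℝ) (hs : 0 < s) (j ℓ : ℕ) (hj : s^2 = j) (hℓ : ℓ ≤ j)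
    (x : ℝ) (hx : |x| ≤ R) :
    |(HH j - trunc' (HH j) ℓ).eval x| ≤
      ∑ m ∈ Finset.Ico ℓ (j+1), Real.exp j * s^(j+m) / m.factorial * R^m := by
  have h1 : HH j = ∑ m ∈ Finset.range (j+1), monomial m ((HH j).coeff m) := by
    apply as_sum_range'
    unfold HH
    refine lt_of_le_of_lt natDegree_map_le ?_
    rw [natDegree_hermite]; omega
  have h2 : HH j - trunc' (HH j) ℓ = ∑ m ∈ Finset.Ico ℓ (j+1), monomial m ((HH j).coeff m) := by
    rw [Finset.sum_Ico_eq_sub _ (by omega), ← h1]; rfl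
  rw [h2, eval_finsetSum]
  refine (Finset.abs_sum_le_sum_abs _ _).trans (Finset.sum_le_sum fun m hm => ?_)
  have hm' : m ≤ j := by have := (Finset.mem_Ico.1 hm).2; omega
  rw [eval_monomial, abs_mul, abs_pow]
  exact mul_le_mul (HH_coeff_le s hs j m hj hm') (by gcongr) (by positivity) (by positivity)

lemma tail_mul (R : ℝ) (hR : 0 < R) (s : ℝ) (hs : 1 ≤ s) (j ℓ i n : ℕ) (hj : s^2 = j)
    (hn : n < ℓ) (hi : i ≤ n) :
    (∑ m ∈ Finset.Ico ℓ (j+1), Real.exp j * s^(j+m) / m.factorial * R^m) * (n.factorial / s^(n-i)) ≤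
      Real.exp j ^ 3 * (1+R)^j * s^(j+i) := by
  have hs0 : 0 < s := by linarith
  have hsj : s ≤ j := by rw [← hj]; nlinarith
  have key : ∀ m ∈ Finset.Ico ℓ (j+1), (Real.exp j * s^(j+m) / m.factorial * R^m) * (n.factorial / s^(n-i))
      ≤ Real.exp j ^ 2 * (1+R)^j * s^(j+i) := by
    intro m hm
    obtain ⟨hm1, hm2⟩ := Finset.mem_Ico.1 hm
    have h1 : ((n.factorial : ℝ)) * (m-n).factorial ≤ m.factorial := by
      have := Nat.factorial_mul_factorial_dvd_factorial (show n ≤ m by omega)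
      exact_mod_cast Nat.le_of_dvd (Nat.factorial_pos m) this
    have h2 : s^(m-n) / (m-n).factorial ≤ Real.exp j :=
      (Real.pow_div_factorial_le_exp s hs0.le (m-n)).trans (Real.exp_le_exp.2 hsj)
    have h3 : R^m ≤ (1+R)^j := by
      calc R^m ≤ (1+R)^m := by gcongr; linarith
        _ ≤ _ := pow_le_pow_right₀ (by linarith) (by omega)
    have h4 : (n.factorial : ℝ) / m.factorial ≤ 1 / (m-n).factorial := by
      rw [div_le_div_iff₀ (by positivity) (by positivity)]; linarith
    have h5 : s^(j+m) = s^(j+i) * s^(m-n) * s^(n-i) := by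
      rw [← pow_add, ← pow_add]; congr 1; omega
    calc _ = Real.exp j * s^(j+i) * R^m * (s^(m-n) * ((n.factorial : ℝ) / m.factorial)) := by
          rw [h5]; field_simp
      _ ≤ Real.exp j * s^(j+i) * (1+R)^j * (s^(m-n) * (1 / (m-n).factorial)) := by gcongr
      _ = Real.exp j * s^(j+i) * (1+R)^j * (s^(m-n) / (m-n).factorial) := by ring
      _ ≤ Real.exp j * s^(j+i) * (1+R)^j * Real.exp j := by gcongr
      _ = _ := by ring
  rw [Finset.sum_mul]
  refine (Finset.sum_le_card_nsmul _ _ _ key).trans ?_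
  rw [nsmul_eq_mul, Nat.card_Ico]
  have : ((j + 1 - ℓ : ℕ) : ℝ) ≤ Real.exp j := by
    have h1 : ((j + 1 - ℓ : ℕ) : ℝ) ≤ ((j+1 : ℕ):ℝ) := by exact_mod_cast Nat.sub_le _ _
    push_cast at h1
    exact h1.trans (Real.add_one_le_exp _)
  calc _ ≤ Real.exp j * (Real.exp j ^ 2 * (1+R)^j * s^(j+i)) := by gcongr
    _ = _ := by ring

open Polynomial in
lemma main_bound (R : ℝ) (hR : 0 < R) : ∃ K : ℝ, 1 ≤ K ∧ ∀ (ℓ i j : ℕ) (hi : i < ℓ), ℓ ≤ j →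
    |((Vmat R ℓ).updateRow ⟨i, hi⟩ (fun a : Fin ℓ => Jint R (hermiteR a) j)).det| ≤
      |(Vmat R ℓ).det| * (K^j * (Real.sqrt j ^ i / Real.sqrt j ^ j)) := by
  obtain ⟨C₀, hC₀, hcoef⟩ := aux_coeff_bound R hR
  set c₀ := Real.sqrt (2 * R * Real.exp (R^2/2)) with hc₀
  have hc₀' : 0 ≤ c₀ := Real.sqrt_nonneg _
  have he : 1 ≤ Real.exp 1 := Real.one_le_exp (by norm_num)
  refine ⟨(1 + c₀) * (C₀ * Real.exp 1 ^ 6 * (1+R)), ?_, ?_⟩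
  · exact one_le_mul_of_one_le_of_one_le (by linarith) (one_le_mul_of_one_le_of_one_le
      (one_le_mul_of_one_le_of_one_le hC₀ (one_le_pow₀ he)) (by linarith))
  intro ℓ i j hi hℓ
  have hj1 : 1 ≤ j := by omega
  have hj1' : (1:ℝ) ≤ j := by exact_mod_cast hj1
  set s := Real.sqrt j with hs
  have hsj : s^2 = j := Real.sq_sqrt (by positivity)
  have hs1 : 1 ≤ s := by rw [hs]; exact Real.one_le_sqrt.2 hj1'
  have hs0 : 0 < s := by linarith
  set d := (Vmat R ℓ).det with hd
  set v : Fin ℓ → ℝ := fun a => Jint R (hermiteR a) j with hv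
  set D : Fin ℓ → ℝ := Matrix.cramer (Vmat R ℓ).transpose v with hD
  have hDi : ((Vmat R ℓ).updateRow ⟨i, hi⟩ v).det = D ⟨i, hi⟩ := by
    rw [hD, Matrix.cramer_transpose_apply]
  have hcr : ∀ a : Fin ℓ, ∑ r : Fin ℓ, D r * Jint R (hermiteR a) r = d * Jint R (hermiteR a) j := by
    intro a
    have h := congrFun (Matrix.mulVec_cramer (Vmat R ℓ).transpose v) a
    rw [Matrix.det_transpose] at h
    calc _ = ∑ r : Fin ℓ, Jint R (hermiteR a) r * D r :=
          Finset.sum_congr rfl fun r _ => mul_comm _ _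
      _ = _ := h
  set Q : ℝ[X] := ∑ r : Fin ℓ, (D r * ((r : ℕ).factorial : ℝ)⁻¹) • HH r with hQ
  set e : ℝ := d * (j.factorial : ℝ)⁻¹ with he'
  have horth : ∀ a < ℓ, BL R (HH a * (Q - e • HH j)) = 0 := by
    intro a ha
    have h := hcr ⟨a, ha⟩
    simp only [Jint_eq] at h
    have hpi : (Real.sqrt (2*π))⁻¹ ≠ 0 := by positivity
    have h2 : (Real.sqrt (2*π))⁻¹ * BL R (HH a * Q) = (Real.sqrt (2*π))⁻¹ * (e * BL R (HH a * HH j)) := by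
      rw [hQ, Finset.mul_sum, map_sum, Finset.mul_sum]
      simp only [mul_smul_comm, map_smul, smul_eq_mul]
      calc _ = _ := Finset.sum_congr rfl fun r _ => by ring
        _ = _ := h
        _ = _ := by rw [he']; ring
    have h3 := mul_left_cancel₀ hpi h2
    rw [mul_sub, map_sub, mul_smul_comm, map_smul, smul_eq_mul, h3, sub_self]
  have horth' : ∀ p : ℝ[X], p.degree < ℓ → BL R (p * (Q - e • HH j)) = 0 := by
    intro p hp
    have := span_HH ((BL R) ∘ₗ (LinearMap.mulRight ℝ (Q - e • HH j))) ℓ (by simpa using horth) p hp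
    simpa using this
  have hQdeg : Q.degree < ℓ := by
    rw [← mem_degreeLT, hQ]
    refine Submodule.sum_mem _ fun r _ => Submodule.smul_mem _ _ ?_
    rw [mem_degreeLT]; exact HH_degree_lt _ _ r.2
  set Q' := Q - e • trunc' (HH j) ℓ with hQ'
  set g := e • (HH j - trunc' (HH j) ℓ) with hg
  have hQ'deg : Q'.degree < ℓ := by
    rw [← mem_degreeLT] at hQdeg ⊢
    exact Submodule.sub_mem _ hQdeg (Submodule.smul_mem _ _ (mem_degreeLT.2 (trunc_degree _ _)))
  have hBB : BL R (Q' * Q') = BL R (Q' * g) := by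
    have h := horth' Q' hQ'deg
    have h2 : Q - e • HH j = Q' - g := by rw [hQ', hg, smul_sub]; abel
    rw [h2, mul_sub, map_sub] at h
    linarith
  set G₀ := ∑ m ∈ Finset.Ico ℓ (j+1), Real.exp j * s^(j+m) / m.factorial * R^m with hG₀
  have hG₀' : 0 ≤ G₀ := Finset.sum_nonneg fun m _ => by positivity
  have hL2 := L2_bound R hR Q' g (|e| * G₀) (by positivity) hBB (by
    intro x hx
    rw [hg, eval_smul, smul_eq_mul, abs_mul]
    exact mul_le_mul_of_nonneg_left (tail_bound R hR s hs0 j ℓ hsj hℓ x hx) (abs_nonneg _))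
  have hc := hcoef ℓ Q' _ (by positivity) hQ'deg hL2
  have hFQ : FF i Q = D ⟨i, hi⟩ := by
    rw [hQ, map_sum]
    simp only [map_smul, FF_HH, smul_eq_mul]
    rw [Finset.sum_eq_single ⟨i, hi⟩]
    · simp; field_simp
    · intro r _ hr
      rw [if_neg, mul_zero]
      intro h; exact hr (Fin.ext h)
    · simp
  have hexp : Real.exp j = Real.exp 1 ^ j := by rw [← Real.exp_nat_mul, mul_one]
  have hterm : ∀ n ∈ Finset.range ℓ, |FF i (monomial n (Q.coeff n))| ≤
      |e| * ((1 + c₀) * (C₀^j * Real.exp j ^ 4 * (1+R)^j) * s^(j+i)) := by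
    intro n hn
    have hn' := Finset.mem_range.1 hn
    refine (FF_abs_le s hs0 i n _).trans ?_
    split_ifs with hin
    swap
    · positivity
    have h1 : |Q.coeff n| ≤ |e| * (Real.exp j * s^(j+n) / n.factorial) + C₀^j * (c₀ * (|e| * G₀)) := by
      have h2 : Q.coeff n = e * (HH j).coeff n + Q'.coeff n := by
        rw [hQ', coeff_sub, coeff_smul, trunc_coeff _ _ _ hn', smul_eq_mul]; ring
      rw [h2]
      refine (abs_add_le _ _).trans (add_le_add ?_ ?_)
      · rw [abs_mul]
        exact mul_le_mul_of_nonneg_left (HH_coeff_le s hs0 j n hsj (by omega)) (abs_nonneg _)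
      · refine (hc n).trans (mul_le_mul_of_nonneg_right ?_ (by positivity))
        exact pow_le_pow_right₀ hC₀ hℓ
    have h3 := tail_mul R hR s hs1 j ℓ i n hsj hn' hin
    rw [← hG₀] at h3
    rw [hsj]
    have hE1 : 1 ≤ Real.exp j := Real.one_le_exp (by positivity)
    have hP1 : (1:ℝ) ≤ C₀^j := one_le_pow₀ hC₀
    have hP2 : (1:ℝ) ≤ (1+R)^j := one_le_pow₀ (by linarith)
    calc _ ≤ (|e| * (Real.exp j * s^(j+n) / n.factorial) + C₀^j * (c₀ * (|e| * G₀))) *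
            (n.factorial * (Real.exp j / s^(n-i))) := by gcongr
      _ = |e| * (Real.exp j ^ 2 * s^(j+i) + c₀ * (C₀^j * Real.exp j * (G₀ * (n.factorial / s^(n-i))))) := by
          have h5 : s^(j+n) = s^(j+i) * s^(n-i) := by
            rw [← pow_add]; congr 1; omega
          rw [h5]; field_simp
      _ ≤ |e| * ((C₀^j * Real.exp j ^ 4 * (1+R)^j) * s^(j+i) +
            c₀ * (C₀^j * Real.exp j * (Real.exp j ^ 3 * (1+R)^j * s^(j+i)))) := by
          gcongr
          calc Real.exp j ^ 2 ≤ Real.exp j ^ 4 := pow_le_pow_right₀ hE1 (by norm_num)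
            _ = 1 * Real.exp j ^ 4 * 1 := by ring
            _ ≤ _ := by gcongr
      _ = _ := by ring
  have hsum : FF i Q = ∑ n ∈ Finset.range ℓ, FF i (monomial n (Q.coeff n)) := by
    rw [← map_sum]
    congr 1
    ext m
    rcases lt_or_ge m ℓ with h | h
    · exact (trunc_coeff Q ℓ m h).symm
    · rw [coeff_eq_zero_of_degree_lt (hQdeg.trans_le (by exact_mod_cast h)),
        show (∑ n ∈ Finset.range ℓ, monomial n (Q.coeff n)).coeff m = 0 from
          coeff_eq_zero_of_degree_lt ((trunc_degree Q ℓ).trans_le (by exact_mod_cast h))]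
  have hfac : (j.factorial : ℝ)⁻¹ ≤ Real.exp j / s^(2*j) := by
    rw [pow_mul, hsj, le_div_iff₀ (by positivity), inv_mul_eq_div]
    exact Real.pow_div_factorial_le_exp _ (by positivity) _
  have habse : |e| ≤ |d| * (Real.exp j / s^(2*j)) := by
    rw [he', abs_mul, abs_of_pos (show 0 < (j.factorial : ℝ)⁻¹ by positivity)]
    gcongr
  rw [hDi, ← hFQ, hsum]
  calc _ ≤ ∑ n ∈ Finset.range ℓ, |FF i (monomial n (Q.coeff n))| := Finset.abs_sum_le_sum_abs _ _
    _ ≤ ∑ n ∈ Finset.range ℓ, |e| * ((1 + c₀) * (C₀^j * Real.exp j ^ 4 * (1+R)^j) * s^(j+i)) :=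
        Finset.sum_le_sum hterm
    _ = ℓ * (|e| * ((1 + c₀) * (C₀^j * Real.exp j ^ 4 * (1+R)^j) * s^(j+i))) := by simp
    _ ≤ Real.exp j * ((|d| * (Real.exp j / s^(2*j))) *
          ((1 + c₀)^j * (C₀^j * Real.exp j ^ 4 * (1+R)^j) * s^(j+i))) := by
        have h1 : (ℓ:ℝ) ≤ Real.exp j := by
          have : (ℓ:ℝ) ≤ j := by exact_mod_cast hℓ
          linarith [Real.add_one_le_exp (j:ℝ)]
        have h2 : 1 + c₀ ≤ (1+c₀)^j := le_self_pow₀ (by linarith) (by omega)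
        gcongr
    _ = _ := by
        rw [hexp, two_mul, pow_add, pow_add, mul_pow, mul_pow, mul_pow]
        field_simp
        ring

/-- For every `R > 0` there exist `c > 0` and `N ≥ 1` (depending only on `R`) such that for all
`k ≥ 1`, `ℓ ≥ 2(2k-1)`, `1 ≤ i ≤ 2k-1`, and `j ≥ max(ℓ, N)`:
`|det(V^{(i→j)})| ≤ 2^{-c·j·log j} · |det V|`, where `V^{(i→j)}` is `V` with its `i`-th row
replaced by the vector `v^{(j)}` with entries `J_{h_a, j}`. -/
theorem abs_det_updateRow_le (R : ℝ) (hR : 0 < R) :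
    ∃ c : ℝ, 0 < c ∧ ∃ N : ℕ, 1 ≤ N ∧
      ∀ (k ℓ : ℕ), 1 ≤ k → 2 * (2 * k - 1) ≤ ℓ →
        ∀ i : ℕ, 1 ≤ i → i ≤ 2 * k - 1 → ∀ hi : i < ℓ,
          ∀ j : ℕ, ℓ ≤ j → N ≤ j →
            |((Vmat R ℓ).updateRow ⟨i, hi⟩ (fun a : Fin ℓ => Jint R (hermiteR a) j)).det| ≤
              (2 : ℝ) ^ (-(c * j * Real.log j)) * |(Vmat R ℓ).det| := by
  obtain ⟨K, hK, hb⟩ := main_bound R hR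
  refine ⟨1/8, by norm_num, ⌈Real.exp (8 * Real.log K)⌉₊ + 1, by omega, ?_⟩
  intro k ℓ hk hkℓ i hi1 hi2 hi j hℓj hNj
  have h := hb ℓ i j hi hℓj
  rw [mul_comm |_|] at h
  refine h.trans (mul_le_mul_of_nonneg_right ?_ (abs_nonneg _))
  have hjpos : (0:ℝ) < j := by
    have : 0 < j := by omega
    exact_mod_cast this
  have hj1 : (1:ℝ) ≤ j := by
    have : 1 ≤ j := by omega
    exact_mod_cast this
  have hlogj : 0 ≤ Real.log j := Real.log_nonneg hj1
  have hN : 8 * Real.log K ≤ Real.log j := by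
    rw [Real.le_log_iff_exp_le hjpos]
    refine (Nat.le_ceil _).trans ?_
    have : ⌈Real.exp (8 * Real.log K)⌉₊ ≤ j := by omega
    exact_mod_cast this
  have hij : 2 * (i:ℝ) ≤ j := by
    have : 2 * i ≤ j := by omega
    exact_mod_cast this
  have hs : 0 < Real.sqrt j := Real.sqrt_pos.2 hjpos
  have hKpos : 0 < K := by linarith
  have hlhs : 0 < K ^ j * (Real.sqrt j ^ i / Real.sqrt j ^ j) := by positivity
  rw [← Real.log_le_log_iff hlhs (by positivity), Real.log_rpow (by norm_num),
    Real.log_mul (by positivity) (by positivity), Real.log_div (by positivity) (by positivity),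
    Real.log_pow, Real.log_pow, Real.log_pow, Real.log_sqrt hjpos.le]
  have hl2 : Real.log 2 ≤ 1 := by
    have := Real.log_le_sub_one_of_pos (show (0:ℝ) < 2 by norm_num)
    linarith
  have e1 : (j:ℝ) * (8 * Real.log K) ≤ j * Real.log j := mul_le_mul_of_nonneg_left hN hjpos.le
  have e2 : 2 * (i:ℝ) * Real.log j ≤ j * Real.log j := mul_le_mul_of_nonneg_right hij hlogj
  have e3 : Real.log 2 * (j * Real.log j) ≤ 1 * (j * Real.log j) :=
    mul_le_mul_of_nonneg_right hl2 (by positivity)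
  linarith
end

section
/- For every R > 0 there exists a constant C > 0 (depending only on R) such that for all integers ℓ ≥ 2, 0 ≤ i ≤ ℓ−1, and j ≥ ℓ with j ≡ i (mod 2), and all x = (x_0, …, x_{ℓ−1}) ∈ [−R, R]^ℓ: |det(P^{(i→j)}(x))| ≤ (j! / (i! · ((j−i)/2)!)) · 2^{C·j} · ∏_{0 ≤ c_1 < c_2 ≤ ℓ−1} |x_{c_1} − x_{c_2}|. -/
open Finset Real

/-- absolute Hermite coefficients -/
noncomputable def dd : ℕ → ℕ → ℝ
  | 0, 0 => 1
  | 0, (_ + 1) => 0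
  | (n + 1), 0 => dd n 1
  | (n + 1), (k + 1) => dd n k + (k + 2) * dd n (k + 2)

lemma dd_nonneg (n k : ℕ) : 0 ≤ dd n k := by
  induction n generalizing k with
  | zero => cases k <;> simp [dd]
  | succ n ih =>
    cases k with
    | zero => simpa [dd] using ih 1
    | succ k =>
      have h1 := ih k
      have h2 := ih (k+2)
      simp only [dd]; positivity

lemma coeff_le_dd (n k : ℕ) : |((Polynomial.hermite n).coeff k : ℝ)| ≤ dd n k := by
  induction n generalizing k with
  | zero => cases k <;> simp [dd, Polynomial.coeff_one]
  | succ n ih =>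
    cases k with
    | zero => rw [Polynomial.coeff_hermite_succ_zero]; simpa [dd] using ih 1
    | succ k =>
      have h1 := ih k
      have h2 := ih (k+2)
      rw [Polynomial.coeff_hermite_succ_succ]
      simp only [dd]; push_cast
      refine (abs_sub _ _).trans ?_
      rw [abs_mul, abs_of_nonneg (by positivity : (0:ℝ) ≤ (k:ℝ)+2)]
      gcongr

lemma dd_gt (n k : ℕ) (h : n < k) : dd n k = 0 := by
  induction n generalizing k with
  | zero => cases k <;> simp_all [dd]
  | succ n ih =>
    cases k with
    | zero => omega
    | succ k => simp [dd, ih k (by omega), ih (k+2) (by omega)]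

lemma dd_par (n k : ℕ) (h : n % 2 ≠ k % 2) : dd n k = 0 := by
  induction n generalizing k with
  | zero => cases k <;> simp_all [dd]
  | succ n ih =>
    cases k with
    | zero => simp [dd, ih 1 (by omega)]
    | succ k => simp [dd, ih k (by omega), ih (k+2) (by omega)]

lemma dd_bound (n k b : ℕ) (h : n = k + 2 * b) :
    dd n k * (k.factorial * b.factorial) ≤ n.factorial := by
  induction n generalizing k b with
  | zero =>
    obtain ⟨rfl, rfl⟩ : k = 0 ∧ b = 0 := by omega
    simp [dd]
  | succ n ih =>
    cases k with
    | zero =>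
      obtain ⟨b, rfl⟩ : ∃ c, b = c + 1 := ⟨b - 1, by omega⟩
      have h1 := ih 1 b (by omega)
      simp only [dd]
      rw [Nat.factorial_succ n, Nat.factorial_succ b]
      push_cast
      have hn : ((b:ℝ)+1) ≤ n + 1 := by norm_cast; omega
      have := dd_nonneg n 1
      calc _ = ((b:ℝ)+1) * (dd n 1 * ((Nat.factorial 1 : ℕ) * b.factorial)) := by simp; ring
        _ ≤ _ := by gcongr
    | succ k =>
      have h1 := ih k b (by omega)
      simp only [dd]
      cases b with
      | zero =>
        rw [dd_gt n (k+2) (by omega)]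
        obtain rfl : n = k := by omega
        rw [Nat.factorial_succ n]
        push_cast
        simp at h1 ⊢
        nlinarith
      | succ b =>
        have h2 := ih (k+2) b (by omega)
        have hn : (n:ℝ) = k + 2 * (b+1) := by norm_cast; omega
        rw [Nat.factorial_succ n, Nat.factorial_succ b, Nat.factorial_succ k]
        rw [Nat.factorial_succ (k+1), Nat.factorial_succ k] at h2
        rw [Nat.factorial_succ b] at h1
        push_cast at *
        have hf : (0:ℝ) ≤ n.factorial := by positivity
        calc _ = ((k:ℝ)+1) * (dd n k * (k.factorial * ((b+1) * b.factorial))) +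
              ((b:ℝ)+1) * (dd n (k + 2) * (((k:ℝ) + 1 + 1) * ((k + 1) * k.factorial) * b.factorial)) := by ring
          _ ≤ ((k:ℝ)+1) * n.factorial + ((b:ℝ)+1) * n.factorial := by gcongr
          _ ≤ _ := by rw [hn]; nlinarith

lemma deriv_hermite (n : ℕ) : Polynomial.derivative (Polynomial.hermite (n+1)) =
    ((n : Polynomial ℤ) + 1) * Polynomial.hermite n := by
  induction n with
  | zero => simp
  | succ n ih =>
    rw [Polynomial.hermite_succ (n+1), Polynomial.derivative_sub, Polynomial.derivative_mul, ih,
      Polynomial.derivative_mul, Polynomial.hermite_succ n]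
    simp
    ring

lemma herm_rec (n : ℕ) (x : ℝ) : x * hermiteR (n+1) x = hermiteR (n+2) x + (n+1) * hermiteR n x := by
  unfold hermiteR
  rw [Polynomial.hermite_succ (n+1), deriv_hermite]
  simp

lemma herm_zero (x : ℝ) : x * hermiteR 0 x = hermiteR 1 x := by
  simp [hermiteR]

lemma pow_eq (n N : ℕ) (h : n < N) (x : ℝ) : x ^ n = ∑ k ∈ range N, dd n k * hermiteR k x := by
  induction n generalizing N with
  | zero =>
    obtain ⟨N, rfl⟩ : ∃ M, N = M + 1 := ⟨N - 1, by omega⟩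
    simp [sum_range_succ', dd, hermiteR]
  | succ n ih =>
    obtain ⟨N, rfl⟩ : ∃ M, N = M + 2 := ⟨N - 2, by omega⟩
    rw [pow_succ, ih (N+1) (by omega), sum_range_succ', sum_range_succ', sum_range_succ']
    simp only [dd]
    have e1 : ∑ k ∈ range N, (dd n (k+1) + ((k+1:ℕ)+2) * dd n (k+1+2)) * hermiteR (k+1+1) x
        = ∑ k ∈ range N, dd n (k+1) * hermiteR (k+2) x +
          ∑ k ∈ range N, ((k+1:ℕ)+2) * dd n (k+1+2) * hermiteR (k+2) x := by
      rw [← sum_add_distrib]; exact sum_congr rfl fun k _ => by ring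
    have e2 : (∑ k ∈ range N, dd n (k+1) * hermiteR (k+1) x) * x =
        ∑ k ∈ range N, dd n (k+1) * hermiteR (k+2) x +
        ∑ k ∈ range N, (k+1) * dd n (k+1) * hermiteR k x := by
      rw [← sum_add_distrib, sum_mul]
      refine sum_congr rfl fun k _ => ?_
      have := herm_rec k x
      linear_combination dd n (k+1) * this
    have e3 : ∑ k ∈ range (N+2), (k+1) * dd n (k+1) * hermiteR k x
        = ∑ k ∈ range N, (k+1) * dd n (k+1) * hermiteR k x := by
      rw [sum_range_succ, sum_range_succ, dd_gt n (N+1) (by omega), dd_gt n (N+1+1) (by omega)]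
      simp
    have e4 : ∑ k ∈ range (N+2), (k+1) * dd n (k+1) * hermiteR k x =
        ∑ k ∈ range N, ((k+1:ℕ)+2) * dd n (k+1+2) * hermiteR (k+2) x + 2 * dd n 2 * hermiteR 1 x
          + dd n 1 * hermiteR 0 x := by
      rw [sum_range_succ', sum_range_succ']
      have : ∀ k : ℕ, (((k + 1 + 1 : ℕ):ℝ) + 1) = ((k+1:ℕ)+2) := by intro k; push_cast; ring
      simp only [this]
      norm_num
    rw [e1, add_mul, e2]
    have := herm_zero x
    norm_num
    norm_num at e1 e2 e3 e4
    linear_combination dd n 0 * this - e3 + e4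

lemma red (R : ℝ) (hR : 0 < R) (l : ℕ) : ∀ (x : Fin l → ℝ), (∀ c, x c ∈ Set.Icc (-R) R) → ∀ m : ℕ,
    ∃ r : ℕ → ℝ, (∀ k, l ≤ k → r k = 0) ∧ (∀ k, m < k → r k = 0) ∧ (∀ k, |r k| ≤ (2*R+1)^m) ∧
      ∀ c, (x c)^m = ∑ k ∈ range l, r k * (x c)^k := by
  induction l with
  | zero =>
    intro x hx m
    exact ⟨fun _ => 0, by simp, by simp, by intro; simp; positivity, fun c => c.elim0⟩
  | succ l ih =>
    intro x hx m
    choose r h1 h2 h3 h4 using ih (fun c => x c.succ) (fun c => hx _)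
    set y := x 0 with hy
    have hyR : |y| ≤ R := abs_le.2 (hx 0)
    let q : ℕ → ℝ := fun k => ∑ t ∈ range m, y^(m-1-t) * r t k
    have hq1 : ∀ k, l ≤ k → q k = 0 := fun k hk => sum_eq_zero fun t _ => by rw [h1 t k hk]; simp
    have hq2 : ∀ k, m ≤ k → q k = 0 := fun k hk => sum_eq_zero fun t ht => by
      rw [h2 t k (by simp at ht; omega)]; simp
    set G := ∑ t ∈ range m, (2*R+1)^t * R^(m-1-t) with hG
    have hGe : G * ((2*R+1) - R) = (2*R+1)^m - R^m := (Commute.all _ _).geom_sum₂_mul m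
    have hq3 : ∀ k, |q k| ≤ G := fun k => by
      refine (abs_sum_le_sum_abs _ _).trans (sum_le_sum fun t _ => ?_)
      rw [abs_mul, abs_pow, mul_comm]
      have := h3 t k
      gcongr
    have hG0 : 0 ≤ G := by positivity
    have hqs : ∀ c : Fin l, (∑ k ∈ range l, q k * (x c.succ)^k) * (x c.succ - y) = (x c.succ)^m - y^m := by
      intro c
      rw [← (Commute.all _ _).geom_sum₂_mul m]
      congr 1
      simp only [q, sum_mul]
      rw [sum_comm]
      refine sum_congr rfl fun t _ => ?_
      rw [h4 t c, sum_mul]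
      exact sum_congr rfl fun k _ => by ring
    refine ⟨fun k => match k with
      | 0 => y^m - y * q 0
      | (k+1) => q k - y * q (k+1), ?_, ?_, ?_, ?_⟩
    · rintro (_|k) hk
      · omega
      · simp [hq1 k (by omega), hq1 (k+1) (by omega)]
    · rintro (_|k) hk
      · omega
      · simp [hq2 k (by omega), hq2 (k+1) (by omega)]
    · rintro (_|k)
      · simp only
        refine (abs_sub _ _).trans ?_
        rw [abs_mul, abs_pow]
        have : |y|^m + |y| * |q 0| ≤ R^m + R * G := by
          have := hq3 0
          gcongr
        nlinarith
      · simp only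
        refine (abs_sub _ _).trans ?_
        rw [abs_mul]
        have : |q k| + |y| * |q (k+1)| ≤ G + R * G := by
          have := hq3 k
          have := hq3 (k+1)
          gcongr
        have : 0 ≤ R^m := by positivity
        nlinarith
    · have key : ∀ z : ℝ, (∑ k ∈ range (l+1), (match k with
          | 0 => y^m - y * q 0
          | (k+1) => q k - y * q (k+1)) * z^k) = y^m + (∑ k ∈ range l, q k * z^k) * (z - y) := by
        intro z
        rw [sum_range_succ']
        simp only
        have e : ∑ k ∈ range l, q k * z^k = ∑ k ∈ range l, q (k+1) * z^(k+1) + q 0 := by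
          have := sum_range_succ' (fun k => q k * z^k) l
          rw [sum_range_succ, hq1 l le_rfl] at this
          simpa using this
        rw [mul_sub]
        nth_rw 2 [e]
        simp only [sub_mul, sum_sub_distrib, add_mul, sum_mul]
        have e' : ∀ k, q k * z^(k+1) = q k * z^k * z := fun k => by ring
        have e'' : ∀ k, y * q (k+1) * z^(k+1) = q (k+1) * z^(k+1) * y := fun k => by ring
        simp only [e', e'']
        ring
      intro c
      rw [key]
      refine Fin.cases ?_ (fun c => ?_) c
      · simp [← hy]
      · rw [hqs]; ring

lemma term_bound (i j k m : ℕ) (hkm : k ≤ m) (hj : i ≤ j) (hp : j % 2 = i % 2) :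
    dd j m * dd k i ≤ (j.factorial : ℝ) / (i.factorial * ((j-i)/2).factorial) * 4^j := by
  have h0 : (0:ℝ) ≤ (j.factorial : ℝ) / (i.factorial * ((j-i)/2).factorial) * 4^j := by positivity
  by_cases c1 : j < m
  · rw [dd_gt j m c1]; simpa using h0
  by_cases c2 : k < i
  · rw [dd_gt k i c2]; simpa using h0
  by_cases c3 : j % 2 = m % 2
  swap
  · rw [dd_par j m c3]; simpa using h0
  by_cases c4 : k % 2 = i % 2
  swap
  · rw [dd_par k i c4]; simpa using h0
  obtain ⟨a, ha⟩ : ∃ a, j = m + 2 * a := ⟨(j-m)/2, by omega⟩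
  obtain ⟨b, hb⟩ : ∃ b, k = i + 2 * b := ⟨(k-i)/2, by omega⟩
  obtain ⟨e, he⟩ : ∃ e, m = k + 2 * e := ⟨(m-k)/2, by omega⟩
  have hs : (j-i)/2 = a + (b + e) := by omega
  have b1 := dd_bound j m a ha
  have b2 := dd_bound k i b hb
  have n1 : (a + (b+e)).factorial ≤ 4^j * (a.factorial * b.factorial * e.factorial) := by
    rw [← Nat.add_choose_mul_factorial_mul_factorial a (b+e),
      ← Nat.add_choose_mul_factorial_mul_factorial b e]
    have u1 : (a + (b+e)).choose (b+e) ≤ 2^j := (Nat.choose_le_two_pow _ _).trans (Nat.pow_le_pow_right (by norm_num) (by omega))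
    have u2 : (b+e).choose e ≤ 2^j := (Nat.choose_le_two_pow _ _).trans (Nat.pow_le_pow_right (by norm_num) (by omega))
    calc _ = ((a + (b+e)).choose (b+e) * (b+e).choose e) * (a.factorial * b.factorial * e.factorial) := by ring
      _ ≤ (2^j*2^j) * (a.factorial * b.factorial * e.factorial) := by gcongr
      _ = _ := by rw [← mul_pow]; norm_num
  have n2 : e.factorial * k.factorial ≤ m.factorial :=
    (Nat.le_of_dvd (Nat.factorial_pos _) (Nat.factorial_mul_factorial_dvd_factorial_add e k)).trans
      (Nat.factorial_le (by omega))
  have n3 : (a + (b+e)).factorial * k.factorial ≤ 4^j * (a.factorial * b.factorial * m.factorial) := by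
    calc _ ≤ (4^j * (a.factorial * b.factorial * e.factorial)) * k.factorial := by gcongr
      _ = 4^j * (a.factorial * b.factorial * (e.factorial * k.factorial)) := by ring
      _ ≤ _ := by gcongr
  have n3' : ((a + (b+e)).factorial : ℝ) * k.factorial ≤ 4^j * (a.factorial * b.factorial * m.factorial) := by
    exact_mod_cast n3
  rw [hs, div_mul_eq_mul_div, le_div_iff₀ (by positivity)]
  have hP : (0:ℝ) < m.factorial * a.factorial * b.factorial := by positivity
  refine le_of_mul_le_mul_right ?_ hP
  have := dd_nonneg k i
  have := dd_nonneg j m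
  calc _ = (dd j m * (m.factorial * a.factorial)) * (dd k i * (i.factorial * b.factorial)) * (a + (b+e)).factorial := by ring
    _ ≤ (j.factorial) * (k.factorial) * (a + (b+e)).factorial := by gcongr
    _ = j.factorial * ((a + (b+e)).factorial * k.factorial) := by ring
    _ ≤ j.factorial * (4^j * (a.factorial * b.factorial * m.factorial)) := by gcongr
    _ = _ := by ring


lemma det_P (l : ℕ) (x : Fin l → ℝ) :
    |(Matrix.of fun r c : Fin l => hermiteR r (x c)).det| =
      ∏ p ∈ Finset.univ.filter (fun p : Fin l × Fin l => p.1 < p.2), |x p.1 - x p.2| := by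
  have h := Matrix.det_eval_matrixOfPolynomials_eq_det_vandermonde x
    (fun i : Fin l => (Polynomial.hermite i).map (Int.castRingHom ℝ))
    (fun i => by rw [(Polynomial.hermite_monic _).natDegree_map, Polynomial.natDegree_hermite])
    (fun i => (Polynomial.hermite_monic _).map _)
  have h2 : (Matrix.of fun r c : Fin l => hermiteR r (x c)).det = (Matrix.vandermonde x).det := by
    rw [h, ← Matrix.det_transpose]
    congr 1
    ext a b
    simp [hermiteR, Polynomial.aeval_def, Polynomial.eval_map]
  rw [h2, Matrix.det_vandermonde, abs_prod, Finset.prod_filter, ← Finset.univ_product_univ,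
    Finset.prod_product]
  refine Finset.prod_congr rfl fun a _ => ?_
  rw [abs_prod, ← Finset.prod_filter]
  refine Finset.prod_congr (by ext; simp) fun b _ => abs_sub_comm _ _

theorem abs_det_hermite_updateRow_le (R : ℝ) (hR : 0 < R) :
    ∃ C : ℝ, 0 < C ∧
      ∀ (ℓ : ℕ), 2 ≤ ℓ → ∀ (i j : ℕ) (hi : i < ℓ), ℓ ≤ j → j % 2 = i % 2 →
        ∀ x : Fin ℓ → ℝ, (∀ c, x c ∈ Set.Icc (-R) R) →
          |((Matrix.of fun r c : Fin ℓ => hermiteR r (x c)).updateRow ⟨i, hi⟩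
              (fun c => hermiteR j (x c))).det| ≤
            ((Nat.factorial j : ℝ) / (Nat.factorial i * Nat.factorial ((j - i) / 2))) *
              (2 : ℝ) ^ (C * j) *
              ∏ p ∈ Finset.univ.filter (fun p : Fin ℓ × Fin ℓ => p.1 < p.2), |x p.1 - x p.2| := by
  refine ⟨Real.logb 2 (16 * (2*R+1)), Real.logb_pos (by norm_num) (by linarith), ?_⟩
  intro l hl i j hi hj hp x hx
  have hC : (2:ℝ) ^ (Real.logb 2 (16 * (2*R+1)) * j) = (16 * (2*R+1))^j := by
    rw [Real.rpow_mul (by norm_num), Real.rpow_logb (by norm_num) (by norm_num) (by positivity),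
      Real.rpow_natCast]
  rw [hC]
  choose r h1 h2 h3 h4 using red R hR l x hx
  let a : Fin l → ℝ := fun s => ∑ m ∈ range (j+1), ∑ k ∈ range l,
    ((Polynomial.hermite j).coeff m : ℝ) * r m k * dd k s
  have hrow : (fun c => hermiteR j (x c)) =
      ∑ s, a s • (Matrix.of fun r c : Fin l => hermiteR r (x c)) s := by
    funext c
    have e1 : hermiteR j (x c) = ∑ m ∈ range (j+1), ((Polynomial.hermite j).coeff m : ℝ) * (x c)^m := by
      rw [hermiteR, Polynomial.aeval_eq_sum_range, Polynomial.natDegree_hermite]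
      simp
    rw [e1]
    simp only [Finset.sum_apply, Pi.smul_apply, smul_eq_mul, Matrix.of_apply, a, sum_mul]
    rw [sum_comm]
    refine sum_congr rfl fun m _ => ?_
    rw [sum_comm, h4 m c, mul_sum]
    refine sum_congr rfl fun k hk => ?_
    rw [pow_eq k l (by simpa using hk), mul_sum, mul_sum,
      Finset.sum_range]
    exact sum_congr rfl fun s _ => by ring
  rw [hrow, Matrix.det_updateRow_sum, smul_eq_mul, abs_mul, det_P]
  refine mul_le_mul_of_nonneg_right ?_ (prod_nonneg fun _ _ => abs_nonneg _)
  set F := (j.factorial : ℝ) / (i.factorial * ((j-i)/2).factorial) with hF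
  have hF0 : 0 ≤ F := by positivity
  have hterm : ∀ m ∈ range (j+1), ∀ k ∈ range l,
      |((Polynomial.hermite j).coeff m : ℝ) * r m k * dd k i| ≤ F * 4^j * (2*R+1)^j := by
    intro m hm k hk
    by_cases hkm : m < k
    · rw [h2 m k hkm]; simp; positivity
    · rw [abs_mul, abs_mul, abs_of_nonneg (dd_nonneg k i)]
      have t := term_bound i j k m (by omega) (by omega) hp
      have u := coeff_le_dd j m
      have v : |r m k| ≤ (2*R+1)^j := (h3 m k).trans
        (pow_le_pow_right₀ (by linarith) (by simp at hm; omega))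
      have w := dd_nonneg k i
      have w' := dd_nonneg j m
      calc _ ≤ dd j m * (2*R+1)^j * dd k i := by gcongr
        _ = dd j m * dd k i * (2*R+1)^j := by ring
        _ ≤ _ := by gcongr
  have hsum : |a ⟨i, hi⟩| ≤ ∑ m ∈ range (j+1), ∑ k ∈ range l, F * 4^j * (2*R+1)^j := by
    refine (abs_sum_le_sum_abs _ _).trans (sum_le_sum fun m hm => ?_)
    exact (abs_sum_le_sum_abs _ _).trans (sum_le_sum fun k hk => hterm m hm k hk)
  refine hsum.trans ?_
  simp only [sum_const, card_range, nsmul_eq_mul]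
  have c1 : ((j+1 : ℕ):ℝ) ≤ 2^j := by exact_mod_cast Nat.lt_two_pow_self
  have c2 : (l:ℝ) ≤ 2^j := le_trans (by exact_mod_cast (by omega : l ≤ j+1)) c1
  calc _ ≤ (2:ℝ)^j * (2^j * (F * 4^j * (2*R+1)^j)) := by gcongr
    _ = F * ((2*2*4)^j * (2*R+1)^j) := by rw [mul_pow, mul_pow]; ring
    _ = _ := by rw [← mul_pow]; norm_num
end

section
/- Let R > 0, ℓ ≥ 2, and let W be the ℓ×ℓ matrix with entries W_{r,c} = ∫_{−R}^{R} e^{−x²/2} h_c(x) h_r(x) dx for r,c ∈ {0,…,ℓ−1}. Then det(W) ≥ ℓ · R · (R/ℓ)^{2(ℓ−1)} · e^{−R²/2} · ∫_{x_0 > ⋯ > x_{ℓ−2}, x ∈ [−R,R]^{ℓ−1}} e^{−(1/2) Σ_{c=0}^{ℓ−2} x_c²} · ∏_{0 ≤ c_1 < c_2 ≤ ℓ−2} (x_{c_1} − x_{c_2})² dx. -/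
open MeasureTheory Real Finset

open Polynomial in
lemma aux_binom (m : ℕ) (hm : 1 ≤ m) :
    (m + 1) ^ 2 * (2 * m).choose m ≤ (m.factorial) ^ 2 * 2 ^ (2 * m + 1) := by
  induction m, hm using Nat.le_induction with
  | base => decide
  | succ m hm ih =>
    have h1 : (2 * (m + 1)).choose (m + 1) ≤ 4 * (2 * m).choose m := by
      have := Nat.succ_mul_centralBinom_succ m
      simp only [Nat.centralBinom] at this
      have h2 : (m + 1) * (2 * (m + 1)).choose (m + 1) ≤ (m + 1) * (4 * (2 * m).choose m) := by
        rw [this]; nlinarith [Nat.zero_le ((2 * m).choose m)]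
      exact Nat.le_of_mul_le_mul_left h2 (by omega)
    have h3 : (m + 1 + 1) ^ 2 ≤ (m + 1) ^ 2 * (m + 1) ^ 2 := by
      have : m + 1 + 1 ≤ (m + 1) * (m + 1) := by nlinarith
      calc _ ≤ ((m + 1) * (m + 1)) ^ 2 := Nat.pow_le_pow_left this 2
        _ = _ := by ring
    calc (m + 1 + 1) ^ 2 * (2 * (m + 1)).choose (m + 1)
        ≤ ((m + 1) ^ 2 * (m + 1) ^ 2) * (4 * (2 * m).choose m) := Nat.mul_le_mul h3 h1
      _ = 4 * (m + 1) ^ 2 * ((m + 1) ^ 2 * (2 * m).choose m) := by ring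
      _ ≤ 4 * (m + 1) ^ 2 * ((m.factorial) ^ 2 * 2 ^ (2 * m + 1)) := Nat.mul_le_mul_left _ ih
      _ = _ := by rw [Nat.factorial_succ]; ring

open Polynomial in
lemma aux_fd (m : ℕ) (p : ℝ[X]) (hp : p.natDegree ≤ m) (h x : ℝ) (hh : 0 < h) :
    (p.coeff m * m.factorial * h ^ m) ^ 2 ≤
      ((2 * m).choose m : ℝ) * ∑ k ∈ range (m + 1), (p.eval (x + k * h)) ^ 2 := by
  rcases hp.lt_or_eq with hlt | heq
  · rw [Polynomial.coeff_eq_zero_of_natDegree_lt hlt]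
    have : 0 ≤ ((2 * m).choose m : ℝ) * ∑ k ∈ range (m + 1), (p.eval (x + k * h)) ^ 2 := by
      positivity
    simpa using this
  · set q : ℝ[X] := p.comp (C h * X + C x) with hq
    have hd : (C h * X + C x : ℝ[X]).natDegree = 1 := natDegree_linear hh.ne'
    have hqd : q.natDegree = m := by rw [hq, natDegree_comp, hd, heq, mul_one]
    have hql : q.leadingCoeff = p.coeff m * h ^ m := by
      rw [hq, leadingCoeff_comp (by rw [hd]; norm_num), leadingCoeff_linear hh.ne', heq,
        ← heq]; rfl
    have h1 := congrFun (Polynomial.fwdDiff_iter_degree_eq_factorial q) 0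
    rw [fwdDiff_iter_eq_sum_shift, hqd, hql] at h1
    have h2 : p.coeff m * m.factorial * h ^ m =
        ∑ k ∈ range (m + 1), ((-1 : ℝ) ^ (m - k) * m.choose k) * p.eval (x + k * h) := by
      have h3 : p.coeff m * m.factorial * h ^ m = p.coeff m * h ^ m * m.factorial := by ring
      rw [h3]
      simp only [Pi.smul_apply, smul_eq_mul, Pi.natCast_apply] at h1
      rw [← h1]
      refine Finset.sum_congr rfl fun k _ => ?_
      have e : h * (k : ℝ) + x = x + k * h := by ring
      simp [hq, e]
    rw [h2]
    refine (Finset.sum_mul_sq_le_sq_mul_sq _ _ _).trans (le_of_eq ?_)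
    congr 1
    rw [← Nat.sum_range_choose_sq]
    push_cast
    refine Finset.sum_congr rfl fun k _ => ?_
    rw [mul_pow, ← pow_mul, mul_comm (m - k), pow_mul]; simp

open Polynomial in
lemma aux_int (m : ℕ) (hm : 1 ≤ m) (p : ℝ[X]) (hp : p.natDegree ≤ m) (R : ℝ) (hR : 0 < R) :
    ((m + 1 : ℕ) : ℝ) * R * (R / (m + 1 : ℕ)) ^ (2 * m) * (p.coeff m) ^ 2 ≤
      ∫ x in (-R)..R, (p.eval x) ^ 2 := by
  set L : ℝ := ((m + 1 : ℕ) : ℝ) with hL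
  have hL0 : 0 < L := by rw [hL]; positivity
  set h : ℝ := 2 * R / L with hh
  have hh0 : 0 < h := by positivity
  have hc : Continuous fun x : ℝ => (p.eval x) ^ 2 := by fun_prop
  have e1 : ∫ x in (-R)..R, (p.eval x) ^ 2 =
      ∑ k ∈ range (m + 1), ∫ x in (-R)..(-R + h), (p.eval (x + k * h)) ^ 2 := by
    have := intervalIntegral.sum_integral_adjacent_intervals (f := fun x : ℝ => (p.eval x) ^ 2)
      (μ := volume) (a := fun k : ℕ => -R + k * h) (n := m + 1)
      (fun k _ => hc.intervalIntegrable _ _)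
    have e2 : -R + ((m + 1 : ℕ) : ℝ) * h = R := by
      rw [hh, ← hL]; field_simp; ring
    rw [e2] at this
    simp only [Nat.cast_zero, zero_mul, add_zero] at this
    rw [← this]
    refine Finset.sum_congr rfl fun k _ => ?_
    rw [intervalIntegral.integral_comp_add_right (fun x : ℝ => (p.eval x) ^ 2)]
    congr 1; push_cast; ring
  have e3 : ((2 * m).choose m : ℝ) * ∫ x in (-R)..R, (p.eval x) ^ 2 =
      ∫ x in (-R)..(-R + h), ((2 * m).choose m : ℝ) *
        ∑ k ∈ range (m + 1), (p.eval (x + k * h)) ^ 2 := by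
    rw [e1, intervalIntegral.integral_const_mul, intervalIntegral.integral_finsetSum]
    intro k _
    exact Continuous.intervalIntegrable (by fun_prop) _ _
  have e4 : h * (p.coeff m * m.factorial * h ^ m) ^ 2 ≤
      ((2 * m).choose m : ℝ) * ∫ x in (-R)..R, (p.eval x) ^ 2 := by
    rw [e3]
    have : h * (p.coeff m * m.factorial * h ^ m) ^ 2 =
      ∫ x in (-R)..(-R + h), (p.coeff m * m.factorial * h ^ m) ^ 2 := by simp
    rw [this]
    apply intervalIntegral.integral_mono_on (by linarith)
    · simp
    · exact Continuous.intervalIntegrable (by fun_prop) _ _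
    · intro x _
      exact aux_fd m p hp h x hh0
  have hb : L ^ 2 * ((2 * m).choose m : ℝ) ≤ (m.factorial : ℝ) ^ 2 * 2 ^ (2 * m + 1) := by
    rw [hL]; exact_mod_cast aux_binom m hm
  have hC : (0 : ℝ) < ((2 * m).choose m : ℝ) := by
    exact_mod_cast Nat.choose_pos (by omega)
  refine le_of_mul_le_mul_left (le_trans ?_ e4) hC
  have e5 : h * (p.coeff m * m.factorial * h ^ m) ^ 2 =
      ((m.factorial : ℝ) ^ 2 * 2 ^ (2 * m + 1)) * (R / L * (R / L) ^ (2 * m) * p.coeff m ^ 2) := by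
    have : h = 2 * (R / L) := by rw [hh]; ring
    rw [this]; ring
  have e6 : ((2 * m).choose m : ℝ) * (L * R * (R / L) ^ (2 * m) * (p.coeff m) ^ 2) =
      (L ^ 2 * ((2 * m).choose m : ℝ)) * (R / L * (R / L) ^ (2 * m) * p.coeff m ^ 2) := by
    have : L * R = L ^ 2 * (R / L) := by field_simp
    rw [this]; ring
  rw [e5, e6]
  gcongr

lemma aux_andreief (n : ℕ) (μ : Measure ℝ) [SigmaFinite μ] (w : ℝ → ℝ) (f : Fin n → ℝ → ℝ)
    (hi : ∀ r c, Integrable (fun x => w x * f c x * f r x) μ) :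
    (n.factorial : ℝ) * (Matrix.of fun r c : Fin n => ∫ x, w x * f c x * f r x ∂μ).det =
      ∫ x : Fin n → ℝ, (∏ i, w (x i)) * (Matrix.of fun i j : Fin n => f j (x i)).det ^ 2
        ∂(Measure.pi fun _ => μ) := by
  set W := (Matrix.of fun r c : Fin n => ∫ x, w x * f c x * f r x ∂μ) with hW
  have h1 : ∀ x : Fin n → ℝ, (∏ i, w (x i)) * (Matrix.of fun i j : Fin n => f j (x i)).det ^ 2 =
      ∑ σ : Equiv.Perm (Fin n), ∑ τ : Equiv.Perm (Fin n),
        ((Equiv.Perm.sign σ : ℤ) : ℝ) * ((Equiv.Perm.sign τ : ℤ) : ℝ) *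
          ∏ i, (w (x i) * f (τ i) (x i) * f (σ i) (x i)) := by
    intro x
    rw [← Matrix.det_transpose, Matrix.det_apply', sq, Finset.sum_mul_sum, Finset.mul_sum]
    refine Finset.sum_congr rfl fun σ _ => ?_
    rw [Finset.mul_sum]
    refine Finset.sum_congr rfl fun τ _ => ?_
    simp only [Matrix.transpose_apply, Matrix.of_apply, Finset.prod_mul_distrib]
    ring
  have h2 : ∀ σ τ : Equiv.Perm (Fin n), Integrable (fun x : Fin n → ℝ =>
      ((Equiv.Perm.sign σ : ℤ) : ℝ) * ((Equiv.Perm.sign τ : ℤ) : ℝ) *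
          ∏ i, (w (x i) * f (τ i) (x i) * f (σ i) (x i))) (Measure.pi fun _ => μ) := by
    intro σ τ
    refine Integrable.const_mul ?_ _
    exact Integrable.fintype_prod (f := fun i y => w y * f (τ i) y * f (σ i) y)
      (fun i => hi _ _)
  simp_rw [h1]
  rw [integral_finsetSum _ (fun σ _ => integrable_finsetSum _ fun τ _ => h2 σ τ)]
  have h3 : ∀ σ : Equiv.Perm (Fin n), ∫ x : Fin n → ℝ, ∑ τ : Equiv.Perm (Fin n),
        ((Equiv.Perm.sign σ : ℤ) : ℝ) * ((Equiv.Perm.sign τ : ℤ) : ℝ) *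
          ∏ i, (w (x i) * f (τ i) (x i) * f (σ i) (x i)) ∂(Measure.pi fun _ => μ) = W.det := by
    intro σ
    rw [integral_finsetSum _ (fun τ _ => h2 σ τ)]
    have h4 : ∀ τ : Equiv.Perm (Fin n), ∫ x : Fin n → ℝ,
        ((Equiv.Perm.sign σ : ℤ) : ℝ) * ((Equiv.Perm.sign τ : ℤ) : ℝ) *
          ∏ i, (w (x i) * f (τ i) (x i) * f (σ i) (x i)) ∂(Measure.pi fun _ => μ) =
        ((Equiv.Perm.sign σ : ℤ) : ℝ) * (((Equiv.Perm.sign τ : ℤ) : ℝ) *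
          ∏ i, (W.submatrix σ id).transpose (τ i) i) := by
      intro τ
      rw [integral_const_mul,
        integral_fintype_prod_eq_prod (f := fun i y => w y * f (τ i) y * f (σ i) y), mul_assoc]
      rfl
    simp_rw [h4]
    rw [← Finset.mul_sum, ← Matrix.det_apply', Matrix.det_transpose, Matrix.det_permute,
      ← mul_assoc]
    rcases Int.units_eq_one_or (Equiv.Perm.sign σ) with h | h <;> simp [h]
  simp_rw [h3]
  simp [Finset.card_univ, Fintype.card_perm]

lemma aux_order (n : ℕ) (μ : Measure ℝ) [SigmaFinite μ] (F : (Fin n → ℝ) → ℝ)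
    (hF0 : ∀ x, 0 ≤ F x) (hs : ∀ (σ : Equiv.Perm (Fin n)) x, F (x ∘ σ) = F x)
    (hFi : Integrable F (Measure.pi fun _ => μ)) :
    (n.factorial : ℝ) * ∫ x in {x : Fin n → ℝ | ∀ c₁ c₂ : Fin n, c₁ < c₂ → x c₂ < x c₁}, F x
      ∂(Measure.pi fun _ => μ) ≤ ∫ x, F x ∂(Measure.pi fun _ => μ) := by
  set ν : Measure (Fin n → ℝ) := Measure.pi fun _ => μ with hν
  set S := {x : Fin n → ℝ | ∀ c₁ c₂ : Fin n, c₁ < c₂ → x c₂ < x c₁} with hS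
  have hSm : MeasurableSet S := by
    have : S = ⋂ c₁ : Fin n, ⋂ c₂ : Fin n, ⋂ _ : c₁ < c₂, {x | x c₂ < x c₁} := by
      ext x; simp [hS]
    rw [this]
    exact MeasurableSet.iInter fun a => MeasurableSet.iInter fun b => MeasurableSet.iInter
      fun _ => measurableSet_lt (measurable_pi_apply b) (measurable_pi_apply a)
  let e : Equiv.Perm (Fin n) → (Fin n → ℝ) ≃ᵐ (Fin n → ℝ) := fun σ =>
    MeasurableEquiv.piCongrLeft (fun _ => ℝ) σ.symm
  have he : ∀ σ x, e σ x = x ∘ σ := by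
    intro σ x
    ext i
    have := MeasurableEquiv.piCongrLeft_apply_apply (β := fun _ => ℝ) σ.symm x (σ i)
    simpa [e] using this
  have hmp : ∀ σ, MeasurePreserving (e σ) ν ν := fun σ =>
    measurePreserving_piCongrLeft (fun _ => μ) σ.symm
  have hI : ∀ σ, ∫ x in (e σ) ⁻¹' S, F x ∂ν = ∫ x in S, F x ∂ν := by
    intro σ
    have := (hmp σ).setIntegral_preimage_emb (e σ).measurableEmbedding F S
    rw [← this]
    refine setIntegral_congr_fun ((e σ).measurable hSm) fun x _ => ?_
    rw [he, hs]
  have hd : Pairwise (Function.onFun Disjoint fun σ => (e σ) ⁻¹' S) := by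
    intro σ τ hne
    rw [Function.onFun, Set.disjoint_left]
    intro x h1 h2
    apply hne
    simp only [Set.mem_preimage, he] at h1 h2
    have s1 : StrictAnti (x ∘ σ) := fun a b h => h1 a b h
    have s2 : StrictAnti (x ∘ τ) := fun a b h => h2 a b h
    have hr : Set.range (x ∘ σ) = Set.range (x ∘ τ) := by
      rw [σ.surjective.range_comp, τ.surjective.range_comp]
    have s3 : x ∘ σ = x ∘ τ := by
      have t1 : StrictMono (fun i => -(x ∘ σ) i) := fun a b h => neg_lt_neg (s1 h)
      have t2 : StrictMono (fun i => -(x ∘ τ) i) := fun a b h => neg_lt_neg (s2 h)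
      have := (StrictMono.range_inj t1 t2).1 (by
        have k1 : (fun i => -(x ∘ σ) i) = Neg.neg ∘ (x ∘ σ) := rfl
        have k2 : (fun i => -(x ∘ τ) i) = Neg.neg ∘ (x ∘ τ) := rfl
        rw [k1, k2, Set.range_comp, Set.range_comp Neg.neg, hr])
      ext i
      have := congrFun this i
      simpa using this
    have hx : Function.Injective x := by
      have := s1.injective
      exact (Function.Injective.of_comp_iff' x σ.bijective).1 this
    ext i
    have := congrFun s3 i
    exact congrArg _ (hx this)
  have hU := integral_iUnion_fintype (μ := ν) (f := F) (fun σ => (e σ).measurable hSm) hd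
    (fun σ => hFi.integrableOn)
  simp_rw [hI] at hU
  have : (n.factorial : ℝ) * ∫ x in S, F x ∂ν = ∫ x in ⋃ σ, (e σ) ⁻¹' S, F x ∂ν := by
    rw [hU]; simp [Finset.card_univ, Fintype.card_perm]
  rw [this]
  exact setIntegral_le_integral hFi (Filter.Eventually.of_forall hF0)

noncomputable def auxW (R : ℝ) (n : ℕ) : Matrix (Fin n) (Fin n) ℝ :=
  Matrix.of fun r c : Fin n =>
        ∫ x in Set.Icc (-R) R, Real.exp (-x ^ 2 / 2) * hermiteR c x * hermiteR r x

noncomputable def auxH (j : ℕ) : Polynomial ℝ := (Polynomial.hermite j).map (Int.castRingHom ℝ)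

lemma auxH_eval (j : ℕ) (x : ℝ) : hermiteR j x = (auxH j).eval x := by
  simp [hermiteR, auxH, Polynomial.aeval_def, Polynomial.eval_map]

lemma auxH_monic (j : ℕ) : (auxH j).Monic := (Polynomial.hermite_monic j).map _

lemma auxH_natDegree (j : ℕ) : (auxH j).natDegree = j := by
  rw [auxH, (Polynomial.hermite_monic j).natDegree_map, Polynomial.natDegree_hermite]

lemma aux_cont (j : ℕ) : Continuous (hermiteR j) := by
  have : hermiteR j = fun x => (auxH j).eval x := funext (auxH_eval j)
  rw [this]; fun_prop

lemma aux_integrable (R : ℝ) (i j : ℕ) : Integrable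
    (fun x => Real.exp (-x ^ 2 / 2) * hermiteR i x * hermiteR j x)
    (volume.restrict (Set.Icc (-R) R)) := by
  have := aux_cont i
  have := aux_cont j
  exact Continuous.integrableOn_Icc (by fun_prop)

noncomputable def auxF (n : ℕ) (x : Fin n → ℝ) : ℝ :=
  Real.exp (-(1 / 2) * ∑ c, (x c) ^ 2) *
            ∏ p ∈ Finset.univ.filter (fun p : Fin n × Fin n => p.1 < p.2),
              (x p.1 - x p.2) ^ 2

lemma auxF_eq (n : ℕ) (x : Fin n → ℝ) : auxF n x =
    (∏ i, Real.exp (-(x i) ^ 2 / 2)) *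
      (Matrix.of fun i j : Fin n => hermiteR j (x i)).det ^ 2 := by
  have h := Matrix.det_eval_matrixOfPolynomials_eq_det_vandermonde x (fun j : Fin n => auxH j)
    (fun i => auxH_natDegree i) (fun i => auxH_monic i)
  simp_rw [auxH_eval]
  rw [← h, Matrix.det_vandermonde, ← Real.exp_sum, auxF]
  congr 1
  · congr 1; rw [Finset.mul_sum]; exact Finset.sum_congr rfl fun i _ => by ring
  · rw [Finset.prod_filter, ← Finset.univ_product_univ, Finset.prod_product, ← Finset.prod_pow]
    refine Finset.prod_congr rfl fun i _ => ?_
    rw [← Finset.prod_pow, ← Finset.prod_filter]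
    refine Finset.prod_congr (by ext; simp) fun j _ => by ring

lemma auxF_nonneg (n : ℕ) (x : Fin n → ℝ) : 0 ≤ auxF n x := by
  rw [auxF_eq]; positivity

lemma auxF_symm (n : ℕ) (σ : Equiv.Perm (Fin n)) (x : Fin n → ℝ) :
    auxF n (x ∘ σ) = auxF n x := by
  rw [auxF_eq, auxF_eq]
  congr 1
  · exact Equiv.prod_comp σ (fun i => Real.exp (-(x i) ^ 2 / 2))
  · have := Matrix.det_permute σ (Matrix.of fun i j : Fin n => hermiteR j (x i))
    have h2 : (Matrix.of fun i j : Fin n => hermiteR j ((x ∘ σ) i)) =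
      (Matrix.of fun i j : Fin n => hermiteR j (x i)).submatrix σ id := rfl
    rw [h2, this]
    rcases Int.units_eq_one_or (Equiv.Perm.sign σ) with h | h <;> simp [h]

lemma aux_detW (R : ℝ) (n : ℕ) : (n.factorial : ℝ) * (auxW R n).det =
    ∫ x, auxF n x ∂(Measure.pi fun _ : Fin n => volume.restrict (Set.Icc (-R) R)) := by
  simp_rw [auxF_eq]
  exact aux_andreief n (volume.restrict (Set.Icc (-R) R)) (fun x => Real.exp (-x ^ 2 / 2))
    (fun j => hermiteR j) (fun r c => aux_integrable R c r)

lemma aux_pi (R : ℝ) (n : ℕ) :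
    (Measure.pi fun _ : Fin n => (volume : Measure ℝ).restrict (Set.Icc (-R) R)) =
    (volume : Measure (Fin n → ℝ)).restrict (Set.univ.pi fun _ => Set.Icc (-R) R) :=
  (Measure.restrict_pi_pi (fun _ : Fin n => (volume : Measure ℝ)) (fun _ => Set.Icc (-R) R)).symm

lemma auxF_int (R : ℝ) (n : ℕ) : Integrable (auxF n)
    (Measure.pi fun _ : Fin n => volume.restrict (Set.Icc (-R) R)) := by
  rw [aux_pi]
  refine ContinuousOn.integrableOn_compact (isCompact_univ_pi fun _ => isCompact_Icc) ?_
  unfold auxF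
  fun_prop

lemma auxW_nonneg (R : ℝ) (n : ℕ) : 0 ≤ (auxW R n).det := by
  have h := aux_detW R n
  have h2 : 0 ≤ (n.factorial : ℝ) * (auxW R n).det := by
    rw [h]; exact integral_nonneg (auxF_nonneg n)
  exact nonneg_of_mul_nonneg_right h2 (by positivity)

lemma aux_rhs (R : ℝ) (n : ℕ) :
    ∫ x in {x : Fin n → ℝ | (∀ c, x c ∈ Set.Icc (-R) R) ∧
            (∀ c₁ c₂ : Fin n, c₁ < c₂ → x c₂ < x c₁)}, auxF n x ≤ (auxW R n).det := by
  have h := aux_order n (volume.restrict (Set.Icc (-R) R)) (auxF n) (auxF_nonneg n)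
    (auxF_symm n) (auxF_int R n)
  rw [← aux_detW] at h
  have h2 := le_of_mul_le_mul_left h (by positivity)
  have hSm : MeasurableSet {x : Fin n → ℝ | ∀ c₁ c₂ : Fin n, c₁ < c₂ → x c₂ < x c₁} := by
    have : {x : Fin n → ℝ | ∀ c₁ c₂ : Fin n, c₁ < c₂ → x c₂ < x c₁} =
        ⋂ c₁ : Fin n, ⋂ c₂ : Fin n, ⋂ _ : c₁ < c₂, {x | x c₂ < x c₁} := by
      ext x; simp
    rw [this]
    exact MeasurableSet.iInter fun a => MeasurableSet.iInter fun b => MeasurableSet.iInter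
      fun _ => measurableSet_lt (measurable_pi_apply b) (measurable_pi_apply a)
  rw [aux_pi, Measure.restrict_restrict hSm] at h2
  have hset : {x : Fin n → ℝ | (∀ c, x c ∈ Set.Icc (-R) R) ∧
            (∀ c₁ c₂ : Fin n, c₁ < c₂ → x c₂ < x c₁)} =
      {x : Fin n → ℝ | ∀ c₁ c₂ : Fin n, c₁ < c₂ → x c₂ < x c₁} ∩
        (Set.univ.pi fun _ => Set.Icc (-R) R) := by
    ext x
    constructor
    · exact fun h => ⟨h.2, fun i _ => h.1 i⟩
    · exact fun h => ⟨fun i => h.2 i trivial, h.1⟩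
  rw [hset]
  exact h2

lemma aux_ratio (R : ℝ) (hR : 0 < R) (m : ℕ) (hm : 1 ≤ m) :
    ((m + 1 : ℕ) : ℝ) * R * (R / (m + 1 : ℕ)) ^ (2 * m) * Real.exp (-R ^ 2 / 2) * (auxW R m).det ≤
      (auxW R (m + 1)).det := by
  rcases (auxW_nonneg R m).eq_or_lt with h0 | hpos
  · rw [← h0, mul_zero]; exact auxW_nonneg R _
  set W := auxW R (m + 1) with hW
  set d := (auxW R m).det with hd
  set u : Fin (m + 1) → ℝ := fun i => W.adjugate i (Fin.last m) with hu
  have hlast : u (Fin.last m) = d := by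
    rw [hu, hd]
    simp only
    rw [Matrix.adjugate_fin_succ_eq_det_submatrix, ← two_mul, pow_mul]
    simp only [neg_one_sq, one_pow, one_mul, Fin.succAbove_last]
    rfl
  have hWu : ∀ r, ∑ c, W r c * u c = if r = Fin.last m then W.det else 0 := by
    intro r
    have := congrFun (congrFun (Matrix.mul_adjugate W) r) (Fin.last m)
    rw [Matrix.mul_apply] at this
    rw [this]
    simp [Matrix.one_apply]
  set p : Polynomial ℝ := ∑ i : Fin (m + 1), Polynomial.C (u i) * auxH i with hp
  have hpe : ∀ x, p.eval x = ∑ i : Fin (m + 1), u i * hermiteR i x := by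
    intro x
    simp [hp, Polynomial.eval_finsetSum, auxH_eval]
  have hpd : p.natDegree ≤ m := by
    refine Polynomial.natDegree_sum_le_of_forall_le _ _ fun i _ => ?_
    refine (Polynomial.natDegree_C_mul_le _ _).trans ?_
    rw [auxH_natDegree]; omega
  have hpc : p.coeff m = d := by
    rw [hp, Polynomial.finsetSum_coeff, Finset.sum_eq_single (Fin.last m)]
    · rw [Polynomial.coeff_C_mul, hlast]
      have := (auxH_monic m).coeff_natDegree
      rw [auxH_natDegree] at this
      simp [this]
    · intro i _ hi
      rw [Polynomial.coeff_C_mul, Polynomial.coeff_eq_zero_of_natDegree_lt, mul_zero]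
      rw [auxH_natDegree]
      exact Fin.val_lt_last hi
    · simp
  have hq : ∫ x in Set.Icc (-R) R, Real.exp (-x ^ 2 / 2) * (p.eval x) ^ 2 = d * W.det := by
    have e1 : ∀ x, Real.exp (-x ^ 2 / 2) * (p.eval x) ^ 2 = ∑ r : Fin (m + 1), ∑ c : Fin (m + 1),
        (u r * u c) * (Real.exp (-x ^ 2 / 2) * hermiteR c x * hermiteR r x) := by
      intro x
      rw [hpe, sq (∑ i : Fin (m + 1), u i * hermiteR i x), Finset.sum_mul_sum, Finset.mul_sum]
      refine Finset.sum_congr rfl fun r _ => ?_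
      rw [Finset.mul_sum]
      exact Finset.sum_congr rfl fun c _ => by ring
    simp_rw [e1]
    rw [integral_finsetSum _ (fun (r : Fin (m + 1)) _ =>
      integrable_finsetSum _ fun (c : Fin (m + 1)) _ => (aux_integrable R c r).const_mul _)]
    have e2 : ∀ r : Fin (m + 1), ∫ x in Set.Icc (-R) R, ∑ c : Fin (m + 1),
        (u r * u c) * (Real.exp (-x ^ 2 / 2) * hermiteR c x * hermiteR r x) =
        u r * if r = Fin.last m then W.det else 0 := by
      intro r
      rw [integral_finsetSum _ (fun (c : Fin (m + 1)) _ => (aux_integrable R c r).const_mul _), ← hWu,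
        Finset.mul_sum]
      refine Finset.sum_congr rfl fun c _ => ?_
      rw [integral_const_mul, hW]
      simp only [auxW, Matrix.of_apply]
      ring
    simp_rw [e2]
    simp [hlast]
  have hlow : Real.exp (-R ^ 2 / 2) * ∫ x in (-R)..R, (p.eval x) ^ 2 ≤ d * W.det := by
    rw [← hq, intervalIntegral.integral_of_le (by linarith), ← integral_Icc_eq_integral_Ioc,
      ← integral_const_mul]
    refine setIntegral_mono_on (Continuous.integrableOn_Icc (by fun_prop))
      (Continuous.integrableOn_Icc (by fun_prop)) measurableSet_Icc fun x hx => ?_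
    refine mul_le_mul_of_nonneg_right (Real.exp_le_exp.2 ?_) (sq_nonneg _)
    have : x ^ 2 ≤ R ^ 2 := sq_le_sq' hx.1 hx.2
    linarith
  have h1 := aux_int m hm p hpd R hR
  rw [hpc] at h1
  have h2 := (mul_le_mul_of_nonneg_left h1 (Real.exp_pos (-R ^ 2 / 2)).le).trans hlow
  refine le_of_mul_le_mul_left (le_trans (le_of_eq ?_) h2) hpos
  ring

/-- Lower bound for the determinant of the matrix `W` with entries
`W_{r,c} = ∫_{-R}^{R} e^{-x²/2} h_c(x) h_r(x) dx`. -/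
theorem det_W_lower_bound (R : ℝ) (hR : 0 < R) (ℓ : ℕ) (hℓ : 2 ≤ ℓ) :
    (Matrix.of fun r c : Fin ℓ =>
        ∫ x in Set.Icc (-R) R, Real.exp (-x ^ 2 / 2) * hermiteR c x * hermiteR r x).det ≥
      (ℓ : ℝ) * R * (R / ℓ) ^ (2 * (ℓ - 1)) * Real.exp (-R ^ 2 / 2) *
        ∫ x in {x : Fin (ℓ - 1) → ℝ | (∀ c, x c ∈ Set.Icc (-R) R) ∧
            (∀ c₁ c₂ : Fin (ℓ - 1), c₁ < c₂ → x c₂ < x c₁)},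
          Real.exp (-(1 / 2) * ∑ c, (x c) ^ 2) *
            ∏ p ∈ Finset.univ.filter (fun p : Fin (ℓ - 1) × Fin (ℓ - 1) => p.1 < p.2),
              (x p.1 - x p.2) ^ 2 := by
  obtain ⟨m, rfl⟩ : ∃ m, ℓ = m + 1 := ⟨ℓ - 1, by omega⟩
  have hm : 1 ≤ m := by omega
  refine le_trans ?_ (aux_ratio R hR m hm)
  exact mul_le_mul_of_nonneg_left (aux_rhs R m) (by positivity)
end

section
/- For every R > 0 there exist constants c > 0 and N ≥ 1 (depending only on R) such that for all integers k ≥ 1, ℓ ≥ max(2(2k−1), N), 1 ≤ i ≤ 2k−1, and j ≥ ℓ: |J_{f_i, j}| ≤ 2^{−c · j · log j}, where f_i := Σ_{a=0}^{ℓ−1} (β_i)_a · h_a and β_i := V^{−1} e_i. -/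
open MeasureTheory Real Finset Matrix

open Polynomial in
theorem xder_hermite (n : ℕ) :
    derivative (hermite (n+1)) = ((n:ℤ)+1) • hermite n := by
  induction n with
  | zero => simp
  | succ n ih =>
    have h2 := hermite_succ (n+1)
    rw [h2, derivative_sub, derivative_mul, ih, derivative_X, derivative_smul, one_mul]
    have h3 := hermite_succ n
    have h4 : derivative (hermite n) = X * hermite n - hermite (n+1) := by rw [h3]; ring
    rw [h4]
    simp only [zsmul_eq_mul]
    push_cast
    ring

open Polynomial in
/-- real Hermite polynomial -/
noncomputable def xh (n : ℕ) : ℝ[X] := (hermite n).map (Int.castRingHom ℝ)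

open Polynomial in
theorem xh_zero : xh 0 = 1 := by simp [xh]

open Polynomial in
theorem xh_X0 : X * xh 0 = xh 1 := by simp [xh]

open Polynomial in
theorem xh_X (n : ℕ) : X * xh (n+1) = xh (n+2) + ((n:ℝ)+1) • xh n := by
  have h := hermite_succ (n+1)
  rw [xder_hermite] at h
  have : X * hermite (n+1) = hermite (n+2) + ((n:ℤ)+1) • hermite n := by rw [h]; ring
  have := congrArg (Polynomial.map (Int.castRingHom ℝ)) this
  simp only [Polynomial.map_mul, map_X, Polynomial.map_add] at this
  unfold xh
  rw [this, zsmul_eq_mul, smul_eq_C_mul]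
  simp

/-- coefficients of monomials in Hermite basis -/
noncomputable def xcc : ℕ → ℕ → ℝ
  | 0, 0 => 1
  | 0, _+1 => 0
  | a+1, 0 => xcc a 1
  | a+1, r+1 => xcc a r + ((r:ℝ)+2) * xcc a (r+2)

theorem xcc_spec (a : ℕ) : ∀ r, (∀ b, a = r + 2*b → xcc a r * r.factorial * (2^b * b.factorial) = a.factorial) ∧
    ((∀ b, a ≠ r + 2*b) → xcc a r = 0) := by
  induction a with
  | zero =>
    intro r
    rcases r with _ | r
    · refine ⟨fun b hb => ?_, fun h => absurd rfl (h 0)⟩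
      obtain rfl : b = 0 := by omega
      simp [xcc]
    · exact ⟨fun b hb => by omega, fun _ => by simp [xcc]⟩
  | succ a ih =>
    intro r
    rcases r with _ | r
    · constructor
      · intro b hb
        rcases b with _ | b
        · omega
        · have := (ih 1).1 b (by omega)
          simp only [xcc, Nat.factorial_succ, Nat.factorial_zero, Nat.cast_mul, pow_succ] at this ⊢
          rw [← this]
          have : (a:ℝ) = 1 + 2*b := by exact_mod_cast (by omega : a = 1 + 2*b)
          push_cast
          rw [this]; ring
      · intro h
        simp only [xcc]
        exact (ih 1).2 (fun b hb => h (b+1) (by omega))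
    · constructor
      · intro b hb
        have h1 := (ih r).1 b (by omega)
        rcases b with _ | b
        · have h2 := (ih (r+2)).2 (fun b hb => by omega)
          simp only [xcc, h2, Nat.factorial_succ, Nat.cast_mul]
          have : (a:ℝ) = r := by exact_mod_cast (by omega : a = r)
          rw [← h1, Nat.cast_succ, Nat.cast_succ, this]; ring
        · have h2 := (ih (r+2)).1 b (by omega)
          have : (a:ℝ) = r + 2 * (b+1) := by exact_mod_cast (by omega : a = r + 2*(b+1))
          have e : (a:ℝ) + 1 = (r+1) + 2 * (b+1) := by rw [this]; ring
          rw [Nat.factorial_succ a, Nat.cast_mul, Nat.cast_succ, e]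
          simp only [xcc, Nat.factorial_succ, Nat.cast_mul, pow_succ] at h1 h2 ⊢
          push_cast at h1 h2 ⊢
          linear_combination ((r:ℝ)+1) * h1 + 2*((b:ℝ)+1) * h2
      · intro h
        simp only [xcc]
        rw [(ih r).2 (fun b hb => h b (by omega)), (ih (r+2)).2 (fun b hb => h (b+1) (by omega))]
        simp

open Polynomial in
theorem xpow_eq (a : ℕ) : (X:ℝ[X])^a = ∑ r ∈ Finset.range (a+1), xcc a r • xh r := by
  induction a with
  | zero => simp [xcc, xh_zero]
  | succ a ih =>
    have hz : ∀ r, a < r → xcc a r = 0 := fun r hr => (xcc_spec a r).2 (fun b hb => by omega)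
    rw [pow_succ', ih, Finset.mul_sum]
    have e1 : ∀ r, X * (xcc a r • xh r) = xcc a r • xh (r+1) + ((r:ℝ) * xcc a r) • xh (r-1) := by
      intro r
      rw [mul_smul_comm]
      rcases r with _ | r
      · simp [xh_X0]
      · rw [xh_X, smul_add, smul_smul]
        simp [mul_comm]
    simp_rw [e1]
    rw [Finset.sum_add_distrib, Finset.sum_range_succ' (fun r => xcc (a+1) r • xh r)]
    simp only [xcc, add_smul]
    rw [Finset.sum_add_distrib, add_assoc]
    congr 1
    have e2 := Finset.sum_range_succ' (fun r => (((r:ℝ)+1) * xcc a (r+1)) • xh r) (a+1)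
    have e3 : ∀ r:ℕ, (((r+1:ℕ):ℝ)+1) = (r:ℝ)+2 := by intro r; push_cast; ring
    simp only [e3] at e2
    rw [Nat.cast_zero, zero_add, one_mul] at e2
    have e4 : ∀ r : ℕ, r+1+1 = r+2 := fun r => rfl
    rw [show (0:ℕ)+1 = 1 from rfl] at e2
    rw [← e2, Finset.sum_range_succ', Finset.sum_range_succ, Finset.sum_range_succ,
      hz (a+1) (by omega), hz (a+1+1) (by omega)]
    simp

open Polynomial in
theorem xmoment (M : ℝ[X] →ₗ[ℝ] ℝ) (ℓ i : ℕ)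
    (hM : ∀ r < ℓ, M (xh r) = if r = i then (i.factorial:ℝ) else 0) (a : ℕ) (ha : a < ℓ) :
    M (X^a) = 0 ∨ ∃ b, a = i + 2*b ∧ |M (X^a)| ≤ a.factorial / b.factorial := by
  have h : M (X^a) = xcc a i * i.factorial := by
    rw [xpow_eq, map_sum]
    simp only [map_smul, smul_eq_mul]
    rw [Finset.sum_congr rfl (fun r hr => by
      rw [hM r (by have := Finset.mem_range.1 hr; omega)])]
    simp only [mul_ite, mul_zero]
    by_cases hi : i ∈ Finset.range (a+1)
    · rw [Finset.sum_ite_eq' ]; simp only [hi, if_true]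
    · rw [Finset.sum_ite_eq' ]; simp only [hi, if_false]
      rw [(xcc_spec a i).2 (fun b hb => hi (Finset.mem_range.2 (by omega)))]; simp
  by_cases hb : ∃ b, a = i + 2*b
  · right
    obtain ⟨b, hb⟩ := hb
    refine ⟨b, hb, ?_⟩
    have h1 := (xcc_spec a i).1 b hb
    rw [← h] at h1
    have hbp : (0:ℝ) < b.factorial := by positivity
    have : |M (X^a)| * (2^b * b.factorial) = a.factorial := by
      rw [← abs_of_nonneg (by positivity : (0:ℝ) ≤ 2^b * b.factorial), ← abs_mul, h1]
      simp
    rw [le_div_iff₀ hbp, ← this]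
    have : (1:ℝ) ≤ 2^b := one_le_pow₀ (by norm_num)
    gcongr
    nlinarith
  · left
    push Not at hb
    rw [h, (xcc_spec a i).2 hb]; simp

open Polynomial in
theorem xcoeff (j a : ℕ) : (xh j).coeff a = 0 ∨ ∃ m, j = a + 2*m ∧
    |(xh j).coeff a| / j.factorial ≤ 1 / (m.factorial * a.factorial) := by
  by_cases hm : ∃ m, j = a + 2*m
  · right
    obtain ⟨m, hm⟩ := hm
    refine ⟨m, hm, ?_⟩
    have e : j = 2*m+a := by omega
    subst e
    rw [xh, coeff_map, coeff_hermite_explicit]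
    simp only [eq_intCast]
    push_cast
    rw [abs_mul, abs_mul, abs_pow, abs_neg, abs_one, one_pow, one_mul, Nat.abs_cast, Nat.abs_cast]
    have h1 : ((2*m+a).choose a * a.factorial * (2*m).factorial) = (2*m+a).factorial := by
      have := Nat.choose_mul_factorial_mul_factorial (show a ≤ 2*m+a by omega)
      simpa using this
    have h2 : (2*m-1).doubleFactorial * m.factorial ≤ (2*m).factorial := by
      rcases m with _ | m
      · simp
      · have := Nat.factorial_eq_mul_doubleFactorial (2*m+1)
        rw [show 2*(m+1) = 2*m+1+1 by ring, this, show 2*m+1+1 = 2*(m+1) by ring,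
          Nat.doubleFactorial_two_mul, show 2*(m+1)-1 = 2*m+1 by omega]
        have : 1 ≤ 2^(m+1) := Nat.one_le_two_pow
        nlinarith [Nat.zero_le ((2*m+1).doubleFactorial * (m+1).factorial)]
    rw [div_le_div_iff₀ (by positivity) (by positivity), one_mul]
    norm_cast
    rw [← h1]
    calc _ = ((2*m-1).doubleFactorial * m.factorial) * ((2*m+a).choose a * a.factorial) := by ring
      _ ≤ (2*m).factorial * ((2*m+a).choose a * a.factorial) := by gcongr
      _ = _ := by ring
  · left
    rw [xh, coeff_map]
    by_cases ho : Odd (j+a)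
    · rw [coeff_hermite_of_odd_add ho]; simp
    · rw [coeff_hermite_of_lt]; · simp
      rw [Nat.not_odd_iff_even] at ho
      by_contra hh
      obtain ⟨t, ht⟩ := ho
      exact hm ⟨t - a, by omega⟩

theorem xfact3 (x y z j : ℕ) (h1 : x+y+z ≤ j) (h2 : j ≤ 4*(x+y+z)) :
    (1:ℝ)/(x.factorial*y.factorial*z.factorial) ≤ 4^j / (j/4).factorial := by
  have a1 : ∀ u v : ℕ, (u+v).factorial ≤ 2^(u+v) * (u.factorial * v.factorial) := by
    intro u v
    have := Nat.add_choose_mul_factorial_mul_factorial u v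
    rw [← this, mul_assoc]
    gcongr
    exact Nat.choose_le_two_pow _ _
  have b1 := a1 x y
  have b2 := a1 (x+y) z
  have b3 : (j/4).factorial ≤ (x+y+z).factorial := Nat.factorial_le (by omega)
  rw [div_le_div_iff₀ (by positivity) (by positivity), one_mul]
  norm_cast
  calc _ ≤ _ := b3
    _ ≤ _ := b2
    _ ≤ 2^(x+y+z) * ((2^(x+y) * (x.factorial * y.factorial)) * z.factorial) := by gcongr
    _ ≤ 2^j * ((2^j * (x.factorial * y.factorial)) * z.factorial) := by
        gcongr <;> omega
    _ = _ := by rw [show 4 = 2*2 by norm_num, mul_pow]; ring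

open Polynomial in
theorem xprod_coeff (v : ℕ → ℝ) (B : ℝ) (hB : 1 ≤ B) (s : Finset ℕ) (hs : ∀ j ∈ s, 1 + |v j| ≤ B) :
    ∀ a, |(∏ j ∈ s, (X - C (v j))).coeff a| ≤ B ^ s.card := by
  induction s using Finset.induction_on with
  | empty =>
    intro a
    simp only [Finset.prod_empty, Finset.card_empty, pow_zero, coeff_one]
    split_ifs <;> simp
  | insert j s hj ih =>
    intro a
    have ih := ih (fun j hj => hs j (Finset.mem_insert_of_mem hj))
    have hb := hs j (Finset.mem_insert_self _ _)
    rw [Finset.prod_insert hj, Finset.card_insert_of_notMem hj, sub_mul, coeff_sub, coeff_C_mul]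
    set P := ∏ j ∈ s, (X - C (v j))
    have h1 : |(X * P).coeff a| ≤ B ^ s.card := by
      rcases a with _ | a
      · simp; positivity
      · rw [coeff_X_mul]; exact ih a
    calc |(X * P).coeff a - v j * P.coeff a| ≤ |(X * P).coeff a| + |v j * P.coeff a| := abs_sub _ _
      _ ≤ B ^ s.card + |v j| * B ^ s.card := by
        rw [abs_mul]; gcongr; exact ih a
      _ = (1 + |v j|) * B ^ s.card := by ring
      _ ≤ B * B ^ s.card := by gcongr
      _ = _ := by ring

theorem xdenom (n k : ℕ) (hk : k ≤ n) :
    ∏ j ∈ (Finset.range (n+1)).erase k, |(k:ℝ) - j| = k.factorial * (n-k).factorial := by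
  have h1 : (Finset.range (n+1)).erase k = Finset.range k ∪ Finset.Ico (k+1) (n+1) := by
    ext x; simp; omega
  have h2 : Disjoint (Finset.range k) (Finset.Ico (k+1) (n+1)) := by
    rw [Finset.disjoint_left]; intro x; simp; omega
  rw [h1, Finset.prod_union h2]
  congr 1
  · rw [← Finset.prod_range_reflect, ← Finset.prod_range_add_one_eq_factorial]
    push_cast
    refine Finset.prod_congr rfl fun x hx => ?_
    have := Finset.mem_range.1 hx
    have e : ((k - 1 - x : ℕ):ℝ) = k - 1 - x := by
      rw [Nat.cast_sub (by omega), Nat.cast_sub (by omega)]; simp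
    rw [e, show (k:ℝ) - (k - 1 - x) = x + 1 by ring, abs_of_nonneg (by positivity)]
  · rw [Finset.prod_Ico_eq_prod_range, ← Finset.prod_range_add_one_eq_factorial,
      show n + 1 - (k+1) = n - k by omega]
    push_cast
    refine Finset.prod_congr rfl fun x hx => ?_
    rw [show (k:ℝ) - (k + 1 + x) = -(x + 1) by ring, abs_neg, abs_of_nonneg (by positivity)]

open Polynomial in
theorem xcoef_bound (R : ℝ) (hR : 0 < R) (n : ℕ) (hn : 1 ≤ n) (F : ℝ[X]) (hF : F.degree < (n+1 : ℕ))
    (T : ℝ) (hT : ∀ x ∈ Set.Icc 0 R, |F.eval x| ≤ T) (a : ℕ) :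
    |F.coeff a| ≤ (4 * Real.exp 1 * (1 + R) / R) ^ n * T := by
  have hn0 : (0:ℝ) < n := by exact_mod_cast hn
  have hT0 : 0 ≤ T := (abs_nonneg _).trans (hT 0 ⟨le_rfl, hR.le⟩)
  set v : ℕ → ℝ := fun j => R / n * j with hv
  have hinj : Set.InjOn v (Finset.range (n+1) : Finset ℕ) := by
    intro x _ y _ h
    simp only [hv] at h
    have := mul_left_cancel₀ (by positivity : R / n ≠ 0) h
    exact_mod_cast this
  have hmem : ∀ j ∈ Finset.range (n+1), v j ∈ Set.Icc 0 R := by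
    intro j hj
    have : (j:ℝ) ≤ n := by
      have := Finset.mem_range.1 hj
      exact_mod_cast (by omega : j ≤ n)
    refine ⟨by positivity, ?_⟩
    calc R / n * j ≤ R / n * n := by gcongr
      _ = R := by field_simp
  have hI := Lagrange.eq_interpolate (s := Finset.range (n+1)) (v := v) (f := F) hinj (by simpa using hF)
  rw [hI, Lagrange.interpolate_apply, finsetSum_coeff]
  have key : ∀ k ∈ Finset.range (n+1),
      |(C (eval (v k) F) * Lagrange.basis (Finset.range (n+1)) v k).coeff a| ≤
        T * (2 * Real.exp 1 * (1 + R) / R) ^ n := by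
    intro k hk
    have hkn : k ≤ n := by have := Finset.mem_range.1 hk; omega
    rw [coeff_C_mul, abs_mul]
    gcongr
    · exact hT _ (hmem k hk)
    rw [Lagrange.basis]
    simp only [Lagrange.basisDivisor]
    rw [Finset.prod_mul_distrib, ← map_prod, coeff_C_mul, abs_mul, Finset.abs_prod]
    have hcard : ((Finset.range (n+1)).erase k).card = n := by
      rw [Finset.card_erase_of_mem hk]; simp
    have h1 := xprod_coeff v (1+R) (by linarith) ((Finset.range (n+1)).erase k) (by
      intro j hj
      have := hmem j (Finset.mem_of_mem_erase hj)
      rw [abs_of_nonneg this.1]; linarith [this.2]) a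
    rw [hcard] at h1
    have h2 : ∏ j ∈ (Finset.range (n+1)).erase k, |(v k - v j)⁻¹| =
        ((R/n)^n * (k.factorial * (n-k).factorial))⁻¹ := by
      rw [← xdenom n k hkn]
      have e0 : (R/(n:ℝ))^n = ∏ _j ∈ (Finset.range (n+1)).erase k, (R/(n:ℝ)) := by
        rw [Finset.prod_const, hcard]
      rw [e0, ← Finset.prod_mul_distrib, ← Finset.prod_inv_distrib]
      refine Finset.prod_congr rfl fun j _ => ?_
      rw [abs_inv, hv]
      simp only
      rw [← mul_sub, abs_mul, abs_of_pos (by positivity : 0 < R / n)]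
    rw [h2]
    have h3 : ((n.factorial : ℕ):ℝ) ≤ 2^n * (k.factorial * (n-k).factorial) := by
      have := Nat.choose_mul_factorial_mul_factorial hkn
      have h4 := Nat.choose_le_two_pow n k
      norm_cast
      rw [← this, mul_assoc]
      gcongr
    have h5 := Real.pow_div_factorial_le_exp (n:ℝ) hn0.le n
    rw [div_le_iff₀ (by positivity)] at h5
    have h6 : ((R/n)^n * ((k.factorial:ℝ) * (n-k).factorial))⁻¹ ≤ (2 * Real.exp 1 / R)^n := by
      rw [inv_le_comm₀ (by positivity) (by positivity), ← inv_pow]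
      have e1 : (2 * Real.exp 1 / R)⁻¹ ^ n = (R/n)^n * ((n:ℝ)^n / (2^n * Real.exp n)) := by
        rw [← Real.exp_one_pow n, ← mul_pow, ← div_pow, ← mul_pow]
        congr 1; field_simp
      rw [e1]
      gcongr
      rw [div_le_iff₀ (by positivity)]
      calc (n:ℝ)^n ≤ Real.exp n * n.factorial := h5
        _ ≤ Real.exp n * (2^n * (k.factorial * (n-k).factorial)) := by gcongr
        _ = _ := by ring
    calc _ ≤ (2 * Real.exp 1 / R)^n * (1+R)^n := by gcongr
      _ = _ := by rw [← mul_pow]; congr 1; ring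
  calc _ ≤ ∑ k ∈ Finset.range (n+1), T * (2 * Real.exp 1 * (1 + R) / R) ^ n :=
        (Finset.abs_sum_le_sum_abs _ _).trans (Finset.sum_le_sum key)
    _ = ((n:ℝ)+1) * (T * (2 * Real.exp 1 * (1 + R) / R) ^ n) := by simp
    _ ≤ 2^n * (T * (2 * Real.exp 1 * (1 + R) / R) ^ n) := by
        gcongr
        exact_mod_cast Nat.lt_two_pow_self
    _ = _ := by
        rw [mul_left_comm, ← mul_pow, mul_comm]; congr 2; ring

open Polynomial in
theorem xcoef_L1 (R : ℝ) (hR : 0 < R) (n : ℕ) (hn : 1 ≤ n) (p : ℝ[X]) (hp : p.degree < n) (a : ℕ) :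
    |p.coeff a| ≤ (8 * Real.exp 1 * (1 + R) / R) ^ n * ∫ x in (-R)..R, |p.eval x| := by
  set F : ℝ[X] := ∑ b ∈ Finset.range n, C (p.coeff b / (b+1)) * X^(b+1) with hF
  have hder : derivative F = p := by
    ext b
    rw [coeff_derivative, hF, finsetSum_coeff]
    simp only [coeff_C_mul, coeff_X_pow, mul_ite, mul_one, mul_zero, add_left_inj]
    rw [Finset.sum_ite_eq]
    split_ifs with h
    · field_simp
    · rw [zero_mul, coeff_eq_zero_of_degree_lt]
      refine hp.trans_le ?_
      simpa using h
  have hdeg : F.degree < (n+1:ℕ) := by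
    rw [degree_lt_iff_coeff_zero]
    intro m hm
    rw [hF, finsetSum_coeff]
    refine Finset.sum_eq_zero fun b hb => ?_
    have := Finset.mem_range.1 hb
    rw [coeff_C_mul, coeff_X_pow, if_neg (by omega), mul_zero]
  have hF0 : F.eval 0 = 0 := by
    rw [hF, eval_finsetSum]; simp
  have hi : ∀ u w, IntervalIntegrable (fun x => p.eval x) volume u w :=
    fun u w => p.continuous.intervalIntegrable _ _
  have hia : ∀ u w, IntervalIntegrable (fun x => |p.eval x|) volume u w :=
    fun u w => p.continuous.abs.intervalIntegrable _ _
  have hb : ∀ x ∈ Set.Icc 0 R, |F.eval x| ≤ ∫ x in (-R)..R, |p.eval x| := by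
    intro x hx
    have h1 : ∫ y in (0:ℝ)..x, p.eval y = F.eval x - F.eval 0 :=
      intervalIntegral.integral_eq_sub_of_hasDerivAt
        (fun y _ => by have := F.hasDerivAt y; rwa [hder] at this) (hi _ _)
    rw [hF0, sub_zero] at h1
    rw [← h1]
    refine (intervalIntegral.abs_integral_le_integral_abs hx.1).trans ?_
    exact intervalIntegral.integral_mono_interval (by linarith) hx.1 hx.2
      (Filter.Eventually.of_forall fun y => abs_nonneg _) (hia _ _)
  have hT0 : 0 ≤ ∫ x in (-R)..R, |p.eval x| := (abs_nonneg _).trans (hb 0 ⟨le_rfl, hR.le⟩)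
  by_cases han : a < n
  · have h1 := xcoef_bound R hR n hn F hdeg _ hb (a+1)
    rw [← hder, coeff_derivative, abs_mul, hder, abs_of_nonneg (by positivity : (0:ℝ) ≤ a + 1)]
    calc _ ≤ ((4 * Real.exp 1 * (1 + R) / R) ^ n * ∫ x in (-R)..R, |p.eval x|) * 2^n := by
          gcongr
          exact_mod_cast (show a + 1 ≤ 2^n from (Nat.lt_two_pow_self (n := n)).le.trans' (by omega))
      _ = _ := by
          rw [mul_right_comm, ← mul_pow]; congr 2; ring
  · rw [coeff_eq_zero_of_degree_lt (hp.trans_le (by exact_mod_cast (by omega : n ≤ a)))]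
    simp only [abs_zero]
    positivity

/-- weight -/
noncomputable def xw (x : ℝ) : ℝ := 1 / Real.sqrt (2 * π) * Real.exp (-x ^ 2 / 2)

theorem xw_cont : Continuous xw := by unfold xw; fun_prop

theorem xw_pos (x : ℝ) : 0 < xw x := by unfold xw; positivity

theorem xw_le_one (x : ℝ) : xw x ≤ 1 := by
  unfold xw
  have h1 : 1 ≤ Real.sqrt (2*π) := by
    rw [Real.one_le_sqrt]; nlinarith [Real.pi_gt_three]
  have h2 : 1 / Real.sqrt (2*π) ≤ 1 := by
    rw [div_le_one (by positivity)]; exact h1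
  have h3 : Real.exp (-x^2/2) ≤ 1 := by
    rw [Real.exp_le_one_iff]; nlinarith [sq_nonneg x]
  calc _ ≤ (1:ℝ) * 1 := by gcongr
    _ = 1 := by ring

theorem xw_lower (R x : ℝ) (hR : 0 < R) (hx : x ∈ Set.Icc (-R) R) : xw R ≤ xw x := by
  have h1 := hx.1
  have h2 := hx.2
  have h : Real.exp (-R^2/2) ≤ Real.exp (-x^2/2) := Real.exp_le_exp.2 (by nlinarith)
  unfold xw
  exact mul_le_mul_of_nonneg_left h (by positivity)

open Polynomial in
/-- the functional -/
noncomputable def xM (R : ℝ) (p : ℝ[X]) : ℝ[X] →ₗ[ℝ] ℝ where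
  toFun q := ∫ x in (-R)..R, p.eval x * xw x * q.eval x
  map_add' q r := by
    have h : ∀ q : ℝ[X], IntervalIntegrable (fun x => p.eval x * xw x * q.eval x) volume (-R) R :=
      fun q => ((p.continuous.mul xw_cont).mul q.continuous).intervalIntegrable _ _
    rw [← intervalIntegral.integral_add (h q) (h r)]
    simp [mul_add]
  map_smul' c q := by
    rw [RingHom.id_apply, smul_eq_mul, ← intervalIntegral.integral_const_mul]
    congr 1; ext x; simp; ring

open Polynomial in
theorem xJint (R : ℝ) (hR : 0 < R) (p : ℝ[X]) (j : ℕ) :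
    Jint R (fun x => p.eval x) j = xM R p (xh j) / j.factorial := by
  unfold Jint
  rw [integral_Icc_eq_integral_Ioc, ← intervalIntegral.integral_of_le (by linarith)]
  simp only [xM, LinearMap.coe_mk, AddHom.coe_mk]
  rw [← intervalIntegral.integral_div]
  congr 1; ext x
  have : hermiteR j x = (xh j).eval x := by
    unfold hermiteR xh
    rw [eval_map, aeval_def]; rfl
  rw [this, xw]
  field_simp

open Polynomial in
theorem xM_pow_le (R : ℝ) (hR : 0 < R) (p : ℝ[X]) (a : ℕ) :
    |xM R p (X^a)| ≤ R^a * ∫ x in (-R)..R, |p.eval x| := by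
  simp only [xM, LinearMap.coe_mk, AddHom.coe_mk]
  refine (intervalIntegral.abs_integral_le_integral_abs (by linarith)).trans ?_
  rw [← intervalIntegral.integral_const_mul]
  refine intervalIntegral.integral_mono_on (by linarith) ?_ ?_ ?_
  · exact ((p.continuous.mul xw_cont).mul (X^a : ℝ[X]).continuous).abs.intervalIntegrable _ _
  · exact (continuous_const.mul p.continuous.abs).intervalIntegrable _ _
  · intro x hx
    have h1 : |x| ≤ R := abs_le.2 hx
    have h2 := xw_le_one x
    have h3 := xw_pos x
    rw [eval_pow, eval_X, abs_mul, abs_mul, abs_pow, abs_of_pos h3]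
    calc |p.eval x| * xw x * |x|^a ≤ |p.eval x| * 1 * R^a := by gcongr
      _ = _ := by ring

open Polynomial in
/-- L1 bound by moments -/
theorem xL1 (R : ℝ) (hR : 0 < R) (n : ℕ) (hn : 1 ≤ n) (p : ℝ[X]) (hp : p.degree < n) :
    ∫ x in (-R)..R, |p.eval x| ≤
      2 * R / xw R * (8 * Real.exp 1 * (1 + R) / R) ^ n * ∑ a ∈ Finset.range n, |xM R p (X^a)| := by
  set T := ∫ x in (-R)..R, |p.eval x| with hT
  have hT0 : 0 ≤ T := intervalIntegral.integral_nonneg (by linarith) (fun x _ => abs_nonneg _)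
  set S := ∑ a ∈ Finset.range n, |xM R p (X^a)| with hS
  set K := (8 * Real.exp 1 * (1 + R) / R) ^ n with hK
  have hw := xw_pos R
  have hS0 : 0 ≤ S := Finset.sum_nonneg fun _ _ => abs_nonneg _
  have hK0 : 0 ≤ K := by positivity
  -- upper bound for the weighted norm
  have h1 : xM R p p ≤ K * T * S := by
    have e : p = ∑ a ∈ Finset.range n, p.coeff a • (X:ℝ[X])^a := by
      have hnd : p.natDegree < n := by
        by_cases h0 : p = 0
        · simp [h0]; omega
        · exact (natDegree_lt_iff_degree_lt h0).2 hp
      conv_lhs => rw [p.as_sum_range' n hnd]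
      exact Finset.sum_congr rfl fun a _ => by rw [smul_eq_C_mul, C_mul_X_pow_eq_monomial]
    have e2 : xM R p p = ∑ a ∈ Finset.range n, p.coeff a * xM R p (X^a) := by
      conv_lhs => rw [congrArg (xM R p) e]
      rw [map_sum]; simp
    rw [e2, hS, Finset.mul_sum]
    refine Finset.sum_le_sum fun a _ => ?_
    refine (le_abs_self _).trans ?_
    rw [abs_mul]
    gcongr
    exact xcoef_L1 R hR n hn p hp a
  -- lower bound
  have h2 : xw R * (T^2 / (2*R)) ≤ xM R p p := by
    have h3 : ∫ x in (-R)..R, xw R * (2 * (T/(2*R)) * |p.eval x| - (T/(2*R))^2) ≤ xM R p p := by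
      simp only [xM, LinearMap.coe_mk, AddHom.coe_mk]
      refine intervalIntegral.integral_mono_on (by linarith) ?_ ?_ ?_
      · exact (continuous_const.mul ((continuous_const.mul p.continuous.abs).sub continuous_const)).intervalIntegrable _ _
      · exact ((p.continuous.mul xw_cont).mul p.continuous).intervalIntegrable _ _
      · intro x hx
        have := xw_lower R x hR hx
        have h4 : 2 * (T/(2*R)) * |p.eval x| - (T/(2*R))^2 ≤ (p.eval x)^2 := by
          rw [← sq_abs (p.eval x)]
          nlinarith [sq_nonneg (|p.eval x| - T/(2*R))]
        calc _ ≤ xw R * (p.eval x)^2 := by gcongr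
          _ ≤ xw x * (p.eval x)^2 := by gcongr
          _ = _ := by ring
    rw [intervalIntegral.integral_const_mul, intervalIntegral.integral_sub,
      intervalIntegral.integral_const_mul, intervalIntegral.integral_const, ← hT] at h3
    · refine le_trans (le_of_eq ?_) h3
      rw [smul_eq_mul]
      field_simp
      ring
    · exact (continuous_const.mul p.continuous.abs).intervalIntegrable _ _
    · exact continuous_const.intervalIntegrable _ _
  rcases hT0.eq_or_lt with h | h
  · rw [← h]; positivity
  · have h5 := h2.trans h1
    have : T * (xw R * T / (2*R)) ≤ T * (K * S) := by
      calc _ = xw R * (T^2 / (2*R)) := by ring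
        _ ≤ _ := h5
        _ = _ := by ring
    have := le_of_mul_le_mul_left this h
    rw [div_le_iff₀ (by positivity)] at this
    calc T = (xw R * T) / xw R := by field_simp
      _ ≤ (K * S * (2*R)) / xw R := by gcongr
      _ = _ := by ring

open Polynomial in
theorem xmain (R : ℝ) (hR : 0 < R) (ℓ i j : ℕ) (hl : 1 ≤ ℓ) (hi : 2*i ≤ ℓ) (hj : ℓ ≤ j)
    (p : ℝ[X]) (hp : p.degree < ℓ)
    (hM : ∀ r < ℓ, xM R p (xh r) = if r = i then (i.factorial:ℝ) else 0) :
    |xM R p (xh j) / j.factorial| ≤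
      ((1 + 2 * R / xw R) * (2 * (1+R) * (8 * Real.exp 1 * (1 + R) / R) * 2 * 4) ^ j * 2) / (j/4).factorial := by
  set K := 8 * Real.exp 1 * (1 + R) / R with hK
  have hK1 : 1 ≤ K := by
    rw [hK, one_le_div hR]
    nlinarith [Real.add_one_le_exp (1:ℝ)]
  have hw := xw_pos R
  set D := (4:ℝ)^j / (j/4).factorial with hD
  have hD0 : 0 ≤ D := by positivity
  have mom := fun a ha => xmoment (xM R p) ℓ i hM a ha
  have hjp : (1:ℝ) ≤ 2^j := one_le_pow₀ (by norm_num)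
  have hKj : 1 ≤ K^j := one_le_pow₀ hK1
  have hRj : 1 ≤ (1+R)^j := one_le_pow₀ (by linarith)
  have hC : 0 ≤ 2 * R / xw R := by positivity
  have term : ∀ a ∈ Finset.range (j+1), |(xh j).coeff a| / j.factorial * |xM R p (X^a)| ≤
      (1 + 2 * R / xw R) * (1+R)^j * K^j * 2^j * D := by
    intro a ha
    have haj : a ≤ j := by have := Finset.mem_range.1 ha; omega
    rcases xcoeff j a with h0 | ⟨m, hm, hco⟩
    · rw [h0]; simp; positivity
    by_cases hal : a < ℓ
    · rcases mom a hal with h0 | ⟨b, hb, hmo⟩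
      · rw [h0]; simp; positivity
      calc _ ≤ 1 / (m.factorial * a.factorial) * (a.factorial / b.factorial : ℝ) := by gcongr
        _ = 1 / (m.factorial * b.factorial * (0:ℕ).factorial) := by
          simp; field_simp
        _ ≤ D := xfact3 m b 0 j (by omega) (by omega)
        _ = 1 * 1 * 1 * 1 * D := by ring
        _ ≤ _ := by gcongr; linarith
    · push Not at hal
      have hT := xM_pow_le R hR p a
      have hL := xL1 R hR ℓ hl p hp
      rw [← hK] at hL
      have inner : 1 / (m.factorial * a.factorial : ℝ) * ∑ a' ∈ Finset.range ℓ, |xM R p (X^a')| ≤ 2^j * D := by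
        rw [Finset.mul_sum]
        calc _ ≤ ∑ a' ∈ Finset.range ℓ, D := by
              refine Finset.sum_le_sum fun a' ha' => ?_
              have ha'l := Finset.mem_range.1 ha'
              rcases mom a' ha'l with h0 | ⟨b, hb, hmo⟩
              · rw [h0]; simp; positivity
              have hf : ((a'.factorial * (a-a').factorial : ℕ):ℝ) ≤ a.factorial := by
                have := Nat.factorial_mul_factorial_dvd_factorial (show a' ≤ a by omega)
                exact_mod_cast Nat.le_of_dvd (Nat.factorial_pos _) this
              push_cast at hf
              calc _ ≤ 1 / (m.factorial * (a'.factorial * (a-a').factorial) : ℝ) * (a'.factorial / b.factorial) := by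
                    gcongr
                _ = 1 / (m.factorial * b.factorial * (a-a').factorial) := by field_simp
                _ ≤ D := xfact3 m b (a-a') j (by omega) (by omega)
          _ = ℓ * D := by simp
          _ ≤ 2^j * D := by
              gcongr
              exact_mod_cast hj.trans (Nat.lt_two_pow_self).le
      have hRa : R^a ≤ (1+R)^j := by
        calc R^a ≤ (1+R)^a := by gcongr; linarith
          _ ≤ (1+R)^j := pow_le_pow_right₀ (by linarith) haj
      have hKl : K^ℓ ≤ K^j := pow_le_pow_right₀ hK1 hj
      have hS0 : 0 ≤ ∑ a' ∈ Finset.range ℓ, |xM R p (X^a')| := Finset.sum_nonneg fun _ _ => abs_nonneg _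
      calc _ ≤ 1 / (m.factorial * a.factorial) * (R^a * (2 * R / xw R * K^ℓ * ∑ a' ∈ Finset.range ℓ, |xM R p (X^a')|)) := by
            gcongr
            exact hT.trans (by gcongr)
        _ = 2 * R / xw R * R^a * K^ℓ * (1 / (m.factorial * a.factorial) * ∑ a' ∈ Finset.range ℓ, |xM R p (X^a')|) := by ring
        _ ≤ (1 + 2 * R / xw R) * (1+R)^j * K^j * (2^j * D) := by
            gcongr; linarith
        _ = _ := by ring
  have e : xM R p (xh j) = ∑ a ∈ Finset.range (j+1), (xh j).coeff a * xM R p (X^a) := by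
    have hnd : (xh j).natDegree < j + 1 := by
      refine Nat.lt_succ_of_le ((natDegree_map_le).trans ?_)
      rw [natDegree_hermite]
    conv_lhs => rw [(xh j).as_sum_range' (j+1) hnd]
    rw [map_sum]
    refine Finset.sum_congr rfl fun a _ => ?_
    rw [← C_mul_X_pow_eq_monomial, ← smul_eq_C_mul, map_smul, smul_eq_mul]
  rw [e, Finset.sum_div]
  calc _ ≤ ∑ a ∈ Finset.range (j+1), (1 + 2 * R / xw R) * (1+R)^j * K^j * 2^j * D := by
        refine (Finset.abs_sum_le_sum_abs _ _).trans (Finset.sum_le_sum fun a ha => ?_)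
        refine le_trans (le_of_eq ?_) (term a ha)
        rw [abs_div, abs_mul, Nat.abs_cast]; ring
    _ = ((j:ℝ)+1) * ((1 + 2 * R / xw R) * (1+R)^j * K^j * 2^j * D) := by simp
    _ ≤ (2 * 2^j) * ((1 + 2 * R / xw R) * (1+R)^j * K^j * 2^j * D) := by
        gcongr
        have : (j:ℝ) ≤ 2^j := by exact_mod_cast (Nat.lt_two_pow_self).le
        linarith
    _ = _ := by
        rw [hD]; simp only [mul_pow]; ring

theorem xfinal (A B : ℝ) (hA : 1 ≤ A) (hB : 1 ≤ B) : ∃ N : ℕ, 1 ≤ N ∧ ∀ j : ℕ, N ≤ j →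
    A * B^j / (j/4).factorial ≤ (2:ℝ)^(-(1/16 * j * Real.log j)) := by
  set c0 := Real.log A + Real.log B + 1 + Real.log 8 with hc0
  refine ⟨⌈Real.exp (16 * c0)⌉₊ + 8, by omega, fun j hj => ?_⟩
  have hj8 : 8 ≤ j := by omega
  have hj8' : (8:ℝ) ≤ j := by exact_mod_cast hj8
  have hj0 : (0:ℝ) < j := by linarith
  have hlog : 16 * c0 ≤ Real.log j := by
    rw [Real.le_log_iff_exp_le hj0]
    refine (Nat.le_ceil _).trans ?_
    exact_mod_cast (by omega : ⌈Real.exp (16 * c0)⌉₊ ≤ j)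
  set q := j/4 with hq
  have hq1 : (j:ℝ)/8 ≤ q := by
    rw [div_le_iff₀ (by norm_num)]
    exact_mod_cast (by omega : j ≤ q * 8)
  have hq2 : (q:ℝ) ≤ j := by exact_mod_cast (by omega : q ≤ j)
  have hq0 : (0:ℝ) < q := by linarith
  have h1 := Real.pow_div_factorial_le_exp (q:ℝ) hq0.le q
  rw [div_le_iff₀ (by positivity)] at h1
  have hA0 : 0 < A := by linarith
  have hB0 : 0 < B := by linarith
  have hlf : q * Real.log q - q ≤ Real.log q.factorial := by
    have := Real.log_le_log (by positivity) h1
    rw [Real.log_mul (by positivity) (by positivity), Real.log_exp, Real.log_pow] at this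
    linarith
  rw [← Real.log_le_log_iff (by positivity) (by positivity), Real.log_div (by positivity) (by positivity),
    Real.log_mul (by positivity) (by positivity), Real.log_pow, Real.log_rpow (by norm_num)]
  have h2 : Real.log j - Real.log 8 ≤ Real.log q := by
    rw [← Real.log_div (by positivity) (by norm_num)]
    exact Real.log_le_log (by positivity) hq1
  have h3 : 0 ≤ Real.log j - Real.log 8 := by
    have := Real.log_le_log (by norm_num) hj8'; linarith
  have h4 : (j:ℝ)/8 * (Real.log j - Real.log 8) ≤ q * Real.log q := by gcongr
  have hlA := Real.log_nonneg hA
  have hl8 : 0 ≤ Real.log 8 := Real.log_nonneg (by norm_num)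
  have hl2 : Real.log 2 ≤ 1 := by linarith [Real.log_two_lt_d9]
  have hlj : 0 ≤ Real.log j := Real.log_nonneg (by linarith)
  have h5 : Real.log A ≤ j * Real.log A := by nlinarith
  have h6 : (j:ℝ) * (16 * c0) ≤ j * Real.log j := by gcongr
  have h7 : (j:ℝ) * Real.log j * Real.log 2 ≤ j * Real.log j * 1 := by gcongr
  have h8 : 0 ≤ (j:ℝ) * Real.log 8 := by positivity
  rw [hc0] at h6
  nlinarith

/-- For every `R > 0` there exist `c > 0` and `N ≥ 1` (depending only on `R`) such that for all
`k ≥ 1`, `ℓ ≥ max(2(2k-1), N)`, `1 ≤ i ≤ 2k-1`, and `j ≥ ℓ`: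
`|J_{fᵢ,j}| ≤ 2^{-c·j·log j}`, where `fᵢ = ∑_a (βᵢ)_a h_a` and `βᵢ = V⁻¹ eᵢ`. -/
theorem abs_J_fi_le (R : ℝ) (hR : 0 < R) :
    ∃ c : ℝ, 0 < c ∧ ∃ N : ℕ, 1 ≤ N ∧
      ∀ (k ℓ : ℕ), 1 ≤ k → 2 * (2 * k - 1) ≤ ℓ → N ≤ ℓ →
        ∀ i : ℕ, 1 ≤ i → i ≤ 2 * k - 1 → ∀ hi : i < ℓ, ∀ j : ℕ, ℓ ≤ j →
          |Jint R
              (fun x => ∑ a : Fin ℓ,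
                ((Vmat R ℓ)⁻¹ *ᵥ Pi.single (⟨i, hi⟩ : Fin ℓ) (1 : ℝ)) a * hermiteR a x) j| ≤
            (2 : ℝ) ^ (-(c * j * Real.log j)) := by
  obtain ⟨N, hN, hfin⟩ := xfinal ((1 + 2 * R / xw R) * 2)
    (2 * (1+R) * (8 * Real.exp 1 * (1 + R) / R) * 2 * 4)
    (by
      have : 0 ≤ 2 * R / xw R := by have := xw_pos R; positivity
      linarith)
    (by
      have h1 : 1 ≤ 8 * Real.exp 1 * (1 + R) / R := by
        rw [one_le_div hR]
        nlinarith [Real.add_one_le_exp (1:ℝ)]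
      nlinarith)
  refine ⟨1/16, by norm_num, N, hN, ?_⟩
  intro k ℓ hk hkl hNl i hi1 hik hi j hj
  set β := (Vmat R ℓ)⁻¹ *ᵥ Pi.single (⟨i, hi⟩ : Fin ℓ) (1 : ℝ) with hβ
  by_cases hV : IsUnit (Vmat R ℓ).det
  swap
  · have : β = 0 := by
      rw [hβ, Matrix.nonsing_inv_apply_not_isUnit _ hV, Matrix.zero_mulVec]
    rw [this]
    simp only [Pi.zero_apply, zero_mul, Finset.sum_const_zero, Jint, integral_zero, abs_zero]
    positivity
  set p : Polynomial ℝ := ∑ a : Fin ℓ, β a • xh a with hp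
  have hev : ∀ (r : ℕ) (x : ℝ), hermiteR r x = (xh r).eval x := by
    intro r x
    unfold hermiteR xh
    rw [Polynomial.eval_map, Polynomial.aeval_def]; rfl
  have hf : (fun x => ∑ a : Fin ℓ, β a * hermiteR a x) = fun x => p.eval x := by
    ext x
    rw [hp, Polynomial.eval_finsetSum]
    simp [hev]
  rw [hf, xJint R hR]
  have hdeg : p.degree < ℓ := by
    rw [hp]
    refine (Polynomial.degree_sum_le _ _).trans_lt ?_
    rw [Finset.sup_lt_iff (by exact WithBot.bot_lt_coe _)]
    intro a _
    refine (Polynomial.degree_smul_le _ _).trans_lt ?_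
    refine (Polynomial.degree_map_le).trans_lt ?_
    rw [Polynomial.degree_hermite]
    exact_mod_cast a.2
  have hM : ∀ r < ℓ, xM R p (xh r) = if r = i then (i.factorial:ℝ) else 0 := by
    intro r hr
    have h1 : Vmat R ℓ *ᵥ β = Pi.single (⟨i, hi⟩ : Fin ℓ) (1 : ℝ) := by
      rw [hβ, Matrix.mulVec_mulVec, Matrix.mul_nonsing_inv _ hV, Matrix.one_mulVec]
    have h2 := congrFun h1 ⟨r, hr⟩
    have h3 : (Vmat R ℓ *ᵥ β) ⟨r, hr⟩ = xM R p (xh r) / r.factorial := by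
      simp only [Matrix.mulVec, dotProduct, Vmat, Matrix.of_apply]
      have hc : ∀ c : Fin ℓ, Jint R (hermiteR c) r = xM R (xh c) (xh r) / r.factorial := by
        intro c
        rw [← xJint R hR]
        congr 1
        ext x; exact hev _ _
      simp only [hc]
      have hlin : xM R p (xh r) = ∑ c : Fin ℓ, β c * xM R (xh c) (xh r) := by
        simp only [xM, LinearMap.coe_mk, AddHom.coe_mk]
        simp only [← intervalIntegral.integral_const_mul]
        rw [← intervalIntegral.integral_finsetSum]
        · congr 1; ext x
          rw [hp, Polynomial.eval_finsetSum, Finset.sum_mul, Finset.sum_mul]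
          refine Finset.sum_congr rfl fun c _ => ?_
          rw [Polynomial.eval_smul, smul_eq_mul]; ring
        · intro c _
          exact (continuous_const.mul (((xh c).continuous.mul xw_cont).mul (xh r).continuous)).intervalIntegrable _ _
      rw [hlin, Finset.sum_div]
      refine Finset.sum_congr rfl fun c _ => ?_
      ring
    rw [h3] at h2
    have hr0 : (r.factorial:ℝ) ≠ 0 := by positivity
    rw [div_eq_iff hr0] at h2
    rw [h2]
    by_cases hri : r = i
    · subst hri; simp
    · rw [if_neg hri, Pi.single_eq_of_ne, zero_mul]
      intro h; exact hri (congrArg Fin.val h)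
  have hmain := xmain R hR ℓ i j (by omega) (by omega) hj p hdeg hM
  refine hmain.trans ?_
  refine le_trans (le_of_eq ?_) (hfin j (by omega))
  ring
end
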